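/- (Flat-type metrics.) In the wrapped product setting take d(r)=r², and assume R_β(x²,x³) ≥ 2 for all (x²,x³)∈Ω. Then for every η₁, η₂ > 0 there is a constant C = C(η₁,η₂) > 0 such that for every solution u of the Dirac equation with initial datum u₀ one has ‖⟨r⟩^{−(3/2+η₁)} u‖²_{L²(M_g)} + ‖⟨r⟩^{−(1/2+η₂)} |∇_h u|‖²_{L²(M_g)} ≤ C ‖Hu₀‖²_{L²(M_h)}, where ⟨r⟩=(1+r²)^{1/2}. -/

import Mathlib

noncomputable section
open MeasureTheory Real Set

abbrev Eu (n : ℕ) : Type := EuclideanSpace ℝ (Fin n)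

def pd {n : ℕ} {F : Type*} [NormedAddCommGroup F] [NormedSpace ℝ F]
    (j : Fin n) (f : Eu n → F) (x : Eu n) : F :=
  fderiv ℝ f x (EuclideanSpace.single j 1)

def Chr {n : ℕ} (h : Eu n → Matrix (Fin n) (Fin n) ℝ) (i j k : Fin n) (x : Eu n) : ℝ :=
  (1/2) * ∑ l, (h x)⁻¹ i l *
    (pd j (fun y => h y l k) x + pd k (fun y => h y j l) x - pd l (fun y => h y j k) x)

def Rscal {n : ℕ} (h : Eu n → Matrix (Fin n) (Fin n) ℝ) (x : Eu n) : ℝ :=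
  ∑ j, ∑ k, (h x)⁻¹ j k *
    ((∑ i, pd i (fun y => Chr h i j k y) x) - (∑ i, pd k (fun y => Chr h i j i y) x)
      + (∑ i, ∑ l, Chr h l j k x * Chr h i i l x) - (∑ i, ∑ l, Chr h l j i x * Chr h i k l x))

def sdet {n : ℕ} (h : Eu n → Matrix (Fin n) (Fin n) ℝ) (x : Eu n) : ℝ := Real.sqrt (h x).det

def lapR {n : ℕ} (h : Eu n → Matrix (Fin n) (Fin n) ℝ) (f : Eu n → ℝ) (x : Eu n) : ℝ :=
  (sdet h x)⁻¹ * ∑ j, pd j (fun y => sdet h y * ∑ k, (h y)⁻¹ j k * pd k f y) x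

def lapC {n : ℕ} (h : Eu n → Matrix (Fin n) (Fin n) ℝ) (f : Eu n → ℂ) (x : Eu n) : ℂ :=
  ((sdet h x : ℝ) : ℂ)⁻¹ *
    ∑ j, pd j (fun y => ((sdet h y : ℝ) : ℂ) * ∑ k, (((h y)⁻¹ j k : ℝ) : ℂ) * pd k f y) x

def jap {n : ℕ} (x : Eu n) : ℝ := Real.sqrt (1 + ‖x‖ ^ 2)

def Hop (A : Fin 3 → Eu 3 → Fin 4 → Fin 4 → ℂ) (B : Eu 3 → Fin 4 → Fin 4 → ℂ)
    (f : Eu 3 → Fin 4 → ℂ) (x : Eu 3) : Fin 4 → ℂ :=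
  fun i => (∑ j, ∑ k, A j x i k * pd j f x k) + ∑ k, B x i k * f x k

def Elliptic (h : Eu 3 → Matrix (Fin 3) (Fin 3) ℝ) (ν N : ℝ) : Prop :=
  ∀ x : Eu 3, ∀ ξ : Fin 3 → ℝ,
    ν * (∑ j, ξ j ^ 2) ≤ (∑ j, ∑ k, (h x)⁻¹ j k * ξ j * ξ k) ∧
      (∑ j, ∑ k, (h x)⁻¹ j k * ξ j * ξ k) ≤ N * (∑ j, ξ j ^ 2)

def opNorm {n : ℕ} (A : Matrix (Fin n) (Fin n) ℝ) : ℝ :=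
  ‖LinearMap.toContinuousLinearMap (Matrix.toEuclideanLin A)‖

def pdM {n : ℕ} (j : Fin n) (H : Eu n → Matrix (Fin n) (Fin n) ℝ) (x : Eu n) :
    Matrix (Fin n) (Fin n) ℝ :=
  Matrix.of fun a b => pd j (fun y => H y a b) x

def AFlat (h : Eu 3 → Matrix (Fin 3) (Fin 3) ℝ) (σ CI Ch : ℝ) : Prop :=
  (∀ x : Eu 3, opNorm ((h x)⁻¹ - 1) ≤ CI * jap x ^ (-σ)) ∧
  (∀ x : Eu 3,
    (∑ j, opNorm (pdM j (fun y => (h y)⁻¹) x))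
      + ‖x‖ * (∑ j, ∑ k, opNorm (pdM j (pdM k (fun y => (h y)⁻¹)) x))
      + ‖x‖ ^ 2 * (∑ j, ∑ k, ∑ l, opNorm (pdM j (pdM k (pdM l (fun y => (h y)⁻¹))) x))
    ≤ Ch * jap x ^ (-(1 + σ)))

def sphInt (f : Eu 3 → ℝ) (R : ℝ) : ℝ :=
  R ^ 2 * ∫ ω : Metric.sphere (0 : Eu 3) 1, f (R • (ω : Eu 3)) ∂(volume.toSphere)

def innC4 (h : Eu 3 → Matrix (Fin 3) (Fin 3) ℝ) (f g : Eu 3 → Fin 4 → ℂ) : ℂ :=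
  ∫ x : Eu 3, (∑ i, (starRingEnd ℂ) (f x i) * g x i) * ((sdet h x : ℝ) : ℂ)

/-- Projection of `ℝ³ = ℝ × ℝ²` onto the last two coordinates. -/
def pr32 (x : Eu 3) : Eu 2 := (EuclideanSpace.equiv (Fin 2) ℝ).symm fun i => x i.succ

/-- The wrapped-product manifold `M = (0,∞) × Ω` as a subset of `ℝ³`. -/
def Mset (Ω : Set (Eu 2)) : Set (Eu 3) := {x : Eu 3 | 0 < x 0 ∧ pr32 x ∈ Ω}

/-- `h` is the wrapped-product metric `dr² + d(r) β` on `M = (0,∞) × Ω`. -/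
def WrapMetric (Ω : Set (Eu 2)) (β : Eu 2 → Matrix (Fin 2) (Fin 2) ℝ) (d : ℝ → ℝ)
    (h : Eu 3 → Matrix (Fin 3) (Fin 3) ℝ) : Prop :=
  ∀ x ∈ Mset Ω, h x 0 0 = 1 ∧ (∀ i : Fin 2, h x 0 i.succ = 0 ∧ h x i.succ 0 = 0) ∧
    ∀ i j : Fin 2, h x i.succ j.succ = d (x 0) * β (pr32 x) i j

/-- `Λ^{k,ij} = ½( h^{kl}∂_l h^{ij} − h^{il}∂_l h^{kj} − h^{jl}∂_l h^{ki} )`. -/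
def LamUp (h : Eu 3 → Matrix (Fin 3) (Fin 3) ℝ) (k i j : Fin 3) (x : Eu 3) : ℝ :=
  (1 / 2) * ∑ l, ((h x)⁻¹ k l * pd l (fun y => (h y)⁻¹ i j) x
      - (h x)⁻¹ i l * pd l (fun y => (h y)⁻¹ k j) x
      - (h x)⁻¹ j l * pd l (fun y => (h y)⁻¹ k i) x)

/-- The inner product `⟨f,g⟩_h = ∫_M (∑ᵢ conj fᵢ gᵢ) √det h` on the wrapped product `M`. -/
def innM (Ω : Set (Eu 2)) (h : Eu 3 → Matrix (Fin 3) (Fin 3) ℝ)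
    (f g : Eu 3 → Fin 4 → ℂ) : ℂ :=
  ∫ x in Mset Ω, (∑ i, (starRingEnd ℂ) (f x i) * g x i) * ((sdet h x : ℝ) : ℂ)

/-- `|∇_h u|² = h^{ij} ∂_i ū ∂_j u` (summed over the `ℂ⁴` components). -/
def gradhSq (h : Eu 3 → Matrix (Fin 3) (Fin 3) ℝ) (u : Eu 3 → Fin 4 → ℂ) (x : Eu 3) : ℝ :=
  ∑ i, ∑ j, (h x)⁻¹ i j *
    ∑ c, ((starRingEnd ℂ) (pd i (fun y => u y c) x) * pd j (fun y => u y c) x).re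

/-- Smoothness on a set. -/
abbrev SmoothOn {n : ℕ} {F : Type*} [NormedAddCommGroup F] [NormedSpace ℝ F]
    (M : Set (Eu n)) (f : Eu n → F) : Prop := ContDiffOn ℝ (⊤ : ℕ∞) f M

/-- Smooth on `M` and vanishing outside a compact subset of `M`. -/
def CS {n : ℕ} {F : Type*} [NormedAddCommGroup F] [NormedSpace ℝ F]
    (M : Set (Eu n)) (f : Eu n → F) : Prop :=
  SmoothOn M f ∧ ∃ K, IsCompact K ∧ K ⊆ M ∧ ∀ x ∉ K, f x = 0

section basics
variable {n : ℕ} {F G : Type*} [NormedAddCommGroup F] [NormedSpace ℝ F]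
  [NormedAddCommGroup G] [NormedSpace ℝ G] {M : Set (Eu n)}

theorem SmoothOn.diffAt {f : Eu n → F} (hf : SmoothOn M f) (hM : IsOpen M) {x : Eu n}
    (hx : x ∈ M) : DifferentiableAt ℝ f x :=
  (hf.contDiffAt (hM.mem_nhds hx)).differentiableAt (by simp)

theorem SmoothOn.pderiv {f : Eu n → F} (hf : SmoothOn M f) (hM : IsOpen M) (j : Fin n) :
    SmoothOn M (pd j f) := by
  have : ContDiffOn ℝ (⊤ : ℕ∞) (fderiv ℝ f) M :=
    hf.fderiv_of_isOpen hM (by simp)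
  exact this.clm_apply contDiffOn_const

theorem pd_congr_of_eventuallyEq {f g : Eu n → F} {x : Eu n} (h : f =ᶠ[nhds x] g) (j : Fin n) :
    pd j f x = pd j g x := by
  unfold pd; rw [h.fderiv_eq]

theorem pd_congr {f g : Eu n → F} (hM : IsOpen M) (h : ∀ x ∈ M, f x = g x) {x : Eu n}
    (hx : x ∈ M) (j : Fin n) : pd j f x = pd j g x :=
  pd_congr_of_eventuallyEq (Filter.mem_of_superset (hM.mem_nhds hx) h) j

theorem pd_const (c : F) (x : Eu n) (j : Fin n) : pd j (fun _ : Eu n => c) x = 0 := by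
  simp [pd]

theorem pd_mul {f g : Eu n → ℝ} {x : Eu n} (hf : DifferentiableAt ℝ f x)
    (hg : DifferentiableAt ℝ g x) (j : Fin n) :
    pd j (fun y => f y * g y) x = f x * pd j g x + pd j f x * g x := by
  unfold pd
  rw [fderiv_fun_mul hf hg]
  simp; ring

theorem pd_smul {f : Eu n → ℝ} {g : Eu n → F} {x : Eu n} (hf : DifferentiableAt ℝ f x)
    (hg : DifferentiableAt ℝ g x) (j : Fin n) :
    pd j (fun y => f y • g y) x = f x • pd j g x + pd j f x • g x := by
  unfold pd
  rw [fderiv_fun_smul hf hg]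
  simp

theorem pd_add {f g : Eu n → F} {x : Eu n} (hf : DifferentiableAt ℝ f x)
    (hg : DifferentiableAt ℝ g x) (j : Fin n) :
    pd j (fun y => f y + g y) x = pd j f x + pd j g x := by
  unfold pd
  rw [fderiv_fun_add hf hg]
  simp

theorem pd_sum {ι : Type*} (s : Finset ι) {f : ι → Eu n → F} {x : Eu n}
    (hf : ∀ i ∈ s, DifferentiableAt ℝ (f i) x) (j : Fin n) :
    pd j (fun y => ∑ i ∈ s, f i y) x = ∑ i ∈ s, pd j (f i) x := by
  unfold pd
  rw [fderiv_fun_sum hf]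
  simp

theorem pd_clm (L : F →L[ℝ] G) {f : Eu n → F} {x : Eu n} (hf : DifferentiableAt ℝ f x)
    (j : Fin n) : pd j (fun y => L (f y)) x = L (pd j f x) := by
  unfold pd
  have := (L.hasFDerivAt.comp x hf.hasFDerivAt).fderiv
  simp only [Function.comp_def] at this
  rw [this]; rfl

theorem pd_comm {f : Eu n → F} (hf : SmoothOn M f) (hM : IsOpen M) {x : Eu n} (hx : x ∈ M)
    (i j : Fin n) : pd i (pd j f) x = pd j (pd i f) x := by
  have h1 : ContDiffAt ℝ (⊤ : ℕ∞) f x := hf.contDiffAt (hM.mem_nhds hx)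
  have h2 : IsSymmSndFDerivAt ℝ f x := h1.isSymmSndFDerivAt (by
    rw [minSmoothness_of_isRCLikeNormedField]; exact WithTop.coe_le_coe.2 le_top)
  have hd : DifferentiableAt ℝ (fderiv ℝ f) x :=
    (h1.fderiv_right (m := 1) (by norm_cast)).differentiableAt (by simp)
  have key : ∀ v w : Eu n, fderiv ℝ (fun y => fderiv ℝ f y v) x w = fderiv ℝ (fderiv ℝ f) x w v := by
    intro v w
    rw [fderiv_clm_apply hd (differentiableAt_const v)]
    simp
  unfold pd
  rw [key, key]
  exact h2 _ _

theorem CS.of_smoothOn {f : Eu n → F} {g : Eu n → G} (hf : CS M f) (hg : SmoothOn M g)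
    (h : ∀ x, f x = 0 → g x = 0) : CS M g := by
  obtain ⟨_, K, h1, h2, h3⟩ := hf
  exact ⟨hg, K, h1, h2, fun x hx => h x (h3 x hx)⟩

theorem CS.pderiv {f : Eu n → F} (hf : CS M f) (hM : IsOpen M) (j : Fin n) : CS M (pd j f) := by
  obtain ⟨hs, K, h1, h2, h3⟩ := hf
  refine ⟨hs.pderiv hM j, K, h1, h2, fun x hx => ?_⟩
  have : pd j f x = pd j (fun _ => (0 : F)) x :=
    pd_congr h1.isClosed.isOpen_compl (fun y hy => h3 y hy) hx j
  rw [this, pd_const]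

theorem CS.add {f g : Eu n → F} (hf : CS M f) (hg : CS M g) : CS M (fun x => f x + g x) := by
  obtain ⟨hs, K, h1, h2, h3⟩ := hf
  obtain ⟨hs', K', h1', h2', h3'⟩ := hg
  refine ⟨hs.add hs', K ∪ K', h1.union h1', union_subset h2 h2', fun x hx => ?_⟩
  rw [mem_union, not_or] at hx
  simp [h3 x hx.1, h3' x hx.2]

theorem CS.zero : CS M (fun _ => (0 : F)) :=
  ⟨contDiffOn_const, ∅, isCompact_empty, empty_subset _, fun _ _ => rfl⟩

theorem CS.sum {ι : Type*} (s : Finset ι) {f : ι → Eu n → F} (hf : ∀ i ∈ s, CS M (f i)) :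
    CS M (fun x => ∑ i ∈ s, f i x) := by
  classical
  induction s using Finset.induction_on with
  | empty => simpa using CS.zero
  | insert a s ha ih =>
    simp_rw [Finset.sum_insert ha]
    exact (hf a (Finset.mem_insert_self _ _)).add
      (ih fun i hi => hf i (Finset.mem_insert_of_mem hi))

theorem CS.mul_left {f g : Eu n → ℝ} (hf : CS M f) (hg : SmoothOn M g) :
    CS M (fun x => g x * f x) :=
  hf.of_smoothOn (hg.mul hf.1) fun x hx => by simp [hx]

theorem CS.smul_left {g : Eu n → ℝ} {f : Eu n → F} (hf : CS M f) (hg : SmoothOn M g) :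
    CS M (fun x => g x • f x) :=
  hf.of_smoothOn (hg.smul hf.1) fun x hx => by simp [hx]

theorem CS.mul_right {f g : Eu n → ℝ} (hf : CS M f) (hg : SmoothOn M g) :
    CS M (fun x => f x * g x) :=
  hf.of_smoothOn (hf.1.mul hg) fun x hx => by simp [hx]

theorem CS.clm (L : F →L[ℝ] G) {f : Eu n → F} (hf : CS M f) : CS M (fun x => L (f x)) :=
  hf.of_smoothOn (L.contDiff.comp_contDiffOn hf.1) fun x hx => by simp [hx]

theorem CS.contDiff {f : Eu n → F} (hf : CS M f) (hM : IsOpen M) : ContDiff ℝ (⊤ : ℕ∞) f := by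
  obtain ⟨hs, K, h1, h2, h3⟩ := hf
  rw [contDiff_iff_contDiffAt]
  intro x
  by_cases hx : x ∈ K
  · exact hs.contDiffAt (hM.mem_nhds (h2 hx))
  · have : f =ᶠ[nhds x] fun _ => 0 :=
      Filter.mem_of_superset (h1.isClosed.isOpen_compl.mem_nhds hx) fun y hy => h3 y hy
    exact contDiffAt_const.congr_of_eventuallyEq this

theorem CS.hasCompactSupport {f : Eu n → F} (hf : CS M f) : HasCompactSupport f := by
  obtain ⟨_, K, h1, _, h3⟩ := hf
  exact HasCompactSupport.intro h1 h3

theorem CS.tsupport_subset {f : Eu n → F} (hf : CS M f) : tsupport f ⊆ M := by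
  obtain ⟨_, K, h1, h2, h3⟩ := hf
  refine subset_trans (closure_minimal (fun x hx => ?_) h1.isClosed) h2
  by_contra h
  exact hx (h3 x h)

theorem CS.eq_zero {f : Eu n → F} (hf : CS M f) {x : Eu n} (hx : x ∉ M) : f x = 0 := by
  obtain ⟨_, K, _, h2, h3⟩ := hf
  exact h3 x fun h => hx (h2 h)

theorem CS.integrable {f : Eu n → F} (hf : CS M f) (hM : IsOpen M) : Integrable f :=
  (hf.contDiff hM).continuous.integrable_of_hasCompactSupport hf.hasCompactSupport

theorem CS.integral_eq {f : Eu n → F} (hf : CS M f) : ∫ x in M, f x = ∫ x, f x :=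
  setIntegral_eq_integral_of_forall_compl_eq_zero fun _ hx => hf.eq_zero hx

theorem CS.integral_pd {f : Eu n → ℝ} (hf : CS M f) (hM : IsOpen M) (j : Fin n) :
    ∫ x in M, pd j f x = 0 := by
  rw [(hf.pderiv hM j).integral_eq]
  have hd := (hf.contDiff hM).differentiable (by simp)
  have := integral_mul_fderiv_eq_neg_fderiv_mul_of_integrable (μ := volume)
    (f := fun _ : Eu n => (1 : ℝ)) (g := f) (v := EuclideanSpace.single j 1)
    (by simp) (by simpa using! (hf.pderiv hM j).integrable hM) (by simpa using hf.integrable hM)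
    (fun x _ => differentiableAt_const _) (fun x _ => hd x)
  simpa using! this

/-- Pointwise comparison up to a divergence. -/
theorem integral_le_of_le_add_pd {P Q f : Eu n → ℝ} (hM : IsOpen M) (hP : IntegrableOn P M)
    (hQ : IntegrableOn Q M) (hf : CS M f) (j : Fin n)
    (h : ∀ x ∈ M, P x ≤ Q x + pd j f x) : ∫ x in M, P x ≤ ∫ x in M, Q x := by
  have h1 : IntegrableOn (pd j f) M := ((hf.pderiv hM j).integrable hM).integrableOn
  calc ∫ x in M, P x ≤ ∫ x in M, (Q x + pd j f x) :=
        setIntegral_mono_on hP (hQ.add h1) hM.measurableSet h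
    _ = _ := by rw [integral_add hQ h1, hf.integral_pd hM, add_zero]

end basics

/-- `pr32` as a continuous linear map. -/
def pr32L : Eu 3 →L[ℝ] Eu 2 :=
  ((EuclideanSpace.equiv (Fin 2) ℝ).symm : (Fin 2 → ℝ) →L[ℝ] Eu 2).comp
    (ContinuousLinearMap.pi fun i => EuclideanSpace.proj (i.succ : Fin 3))

theorem pr32L_apply (x : Eu 3) : pr32L x = pr32 x := rfl

theorem pr32_apply (x : Eu 3) (i : Fin 2) : pr32 x i = x i.succ := rfl

theorem pr32L_single_zero : pr32L (EuclideanSpace.single 0 1) = 0 := by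
  ext i; rw [pr32L_apply, pr32_apply]; simp

theorem pr32L_single_succ (j : Fin 2) :
    pr32L (EuclideanSpace.single j.succ 1) = EuclideanSpace.single j 1 := by
  ext i; rw [pr32L_apply, pr32_apply]; simp

theorem Mset_eq (Ω : Set (Eu 2)) :
    Mset Ω = (EuclideanSpace.proj (0 : Fin 3) : Eu 3 →L[ℝ] ℝ) ⁻¹' (Ioi 0) ∩ pr32L ⁻¹' Ω := rfl

theorem isOpen_Mset {Ω : Set (Eu 2)} (hΩ : IsOpen Ω) : IsOpen (Mset Ω) := by
  rw [Mset_eq]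
  exact (isOpen_Ioi.preimage (ContinuousLinearMap.continuous _)).inter
    (hΩ.preimage (ContinuousLinearMap.continuous _))

section chain
variable {F : Type*} [NormedAddCommGroup F] [NormedSpace ℝ F] {Ω : Set (Eu 2)}

theorem smoothOn_comp_pr32 {g : Eu 2 → F} (hg : SmoothOn Ω g) :
    SmoothOn (Mset Ω) fun x => g (pr32 x) :=
  ContDiffOn.comp hg pr32L.contDiff.contDiffOn fun _ hx => hx.2

theorem smoothOn_radial {m : ℝ → F} (hm : ContDiffOn ℝ (⊤ : ℕ∞) m (Ioi 0)) :
    SmoothOn (Mset Ω) fun x => m (x 0) :=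
  ContDiffOn.comp hm (EuclideanSpace.proj (0 : Fin 3) : Eu 3 →L[ℝ] ℝ).contDiff.contDiffOn
    fun _ hx => hx.1

theorem pd_zero_comp_pr32 {g : Eu 2 → F} {x : Eu 3} (hg : DifferentiableAt ℝ g (pr32 x)) :
    pd 0 (fun y => g (pr32 y)) x = 0 := by
  have : HasFDerivAt (fun y => g (pr32 y)) _ x :=
    HasFDerivAt.comp (f := pr32L) x hg.hasFDerivAt pr32L.hasFDerivAt
  unfold pd
  rw [this.fderiv, ContinuousLinearMap.comp_apply, pr32L_single_zero, map_zero]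

theorem pd_succ_comp_pr32 {g : Eu 2 → F} {x : Eu 3} (hg : DifferentiableAt ℝ g (pr32 x))
    (j : Fin 2) : pd j.succ (fun y => g (pr32 y)) x = pd j g (pr32 x) := by
  have : HasFDerivAt (fun y => g (pr32 y)) _ x :=
    HasFDerivAt.comp (f := pr32L) x hg.hasFDerivAt pr32L.hasFDerivAt
  unfold pd
  rw [this.fderiv, ContinuousLinearMap.comp_apply, pr32L_single_succ]

theorem hasFDerivAt_radial {m : ℝ → ℝ} {m' : ℝ} {x : Eu 3} (hm : HasDerivAt m m' (x 0)) :
    HasFDerivAt (fun y : Eu 3 => m (y 0))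
      (m' • (EuclideanSpace.proj (0 : Fin 3) : Eu 3 →L[ℝ] ℝ)) x :=
  HasDerivAt.comp_hasFDerivAt (f := (EuclideanSpace.proj (0 : Fin 3) : Eu 3 →L[ℝ] ℝ)) x hm
    (ContinuousLinearMap.hasFDerivAt _)

theorem pd_zero_radial {m : ℝ → ℝ} {m' : ℝ} {x : Eu 3} (hm : HasDerivAt m m' (x 0)) :
    pd 0 (fun y : Eu 3 => m (y 0)) x = m' := by
  unfold pd; rw [(hasFDerivAt_radial hm).fderiv]; simp

theorem pd_succ_radial {m : ℝ → ℝ} {m' : ℝ} {x : Eu 3} (hm : HasDerivAt m m' (x 0))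
    (j : Fin 2) : pd j.succ (fun y : Eu 3 => m (y 0)) x = 0 := by
  unfold pd; rw [(hasFDerivAt_radial hm).fderiv]; simp

end chain

/-- A positive smooth metric `β` on an open set `Ω` and a metric `h` equal to `dr² + r² β`
over `Ω`. -/
structure Cone (Ω : Set (Eu 2)) (β : Eu 2 → Matrix (Fin 2) (Fin 2) ℝ)
    (h : Eu 3 → Matrix (Fin 3) (Fin 3) ℝ) : Prop where
  isOpen : IsOpen Ω
  smooth : ∀ i j : Fin 2, SmoothOn Ω (fun y => β y i j)
  symm : ∀ y ∈ Ω, (β y).IsSymm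
  posDef : ∀ y ∈ Ω, (β y).PosDef
  wrap : WrapMetric Ω β (fun r => r ^ 2) h

section cone
variable {Ω : Set (Eu 2)} {β : Eu 2 → Matrix (Fin 2) (Fin 2) ℝ}
  {h : Eu 3 → Matrix (Fin 3) (Fin 3) ℝ}

namespace Cone

theorem isOpen_M (H : Cone Ω β h) : IsOpen (Mset Ω) := isOpen_Mset H.isOpen

theorem det_pos (H : Cone Ω β h) {y : Eu 2} (hy : y ∈ Ω) : 0 < (β y).det :=
  (H.posDef y hy).det_pos

theorem sdet_pos (H : Cone Ω β h) {y : Eu 2} (hy : y ∈ Ω) : 0 < sdet β y :=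
  Real.sqrt_pos.2 (H.det_pos hy)

theorem smoothOn_det (H : Cone Ω β h) : SmoothOn Ω fun y => (β y).det := by
  simp_rw [Matrix.det_fin_two]
  exact ((H.smooth 0 0).mul (H.smooth 1 1)).sub ((H.smooth 0 1).mul (H.smooth 1 0))

theorem smoothOn_sdet (H : Cone Ω β h) : SmoothOn Ω (sdet β) :=
  H.smoothOn_det.sqrt fun _ hy => (H.det_pos hy).ne'

theorem smoothOn_inv (H : Cone Ω β h) (i j : Fin 2) : SmoothOn Ω fun y => (β y)⁻¹ i j := by
  have h1 : SmoothOn Ω fun y => (β y).det⁻¹ := H.smoothOn_det.inv fun _ hy => (H.det_pos hy).ne'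
  have : (fun y => (β y)⁻¹ i j) = fun y => (β y).det⁻¹ * (β y).adjugate i j := by
    funext y; rw [Matrix.inv_def]; simp
  rw [this]
  refine h1.mul ?_
  simp_rw [Matrix.adjugate_fin_two]
  fin_cases i <;> fin_cases j <;> simp [H.smooth] <;> exact (H.smooth _ _).neg

theorem smoothOn_Chr (H : Cone Ω β h) (i j k : Fin 2) : SmoothOn Ω (Chr β i j k) := by
  have hp : ∀ a b c, SmoothOn Ω fun x => pd a (fun y => β y b c) x := fun a b c =>
    (H.smooth b c).pderiv H.isOpen a
  exact contDiffOn_const.mul (ContDiffOn.sum fun l _ =>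
    (H.smoothOn_inv i l).mul (((hp _ _ _).add (hp _ _ _)).sub (hp _ _ _)))

theorem smoothOn_Rscal (H : Cone Ω β h) : SmoothOn Ω (Rscal β) := by
  have hp : ∀ a b c d, SmoothOn Ω fun x => pd a (fun y => Chr β b c d y) x := fun a b c d =>
    (H.smoothOn_Chr b c d).pderiv H.isOpen a
  exact ContDiffOn.sum fun j _ => ContDiffOn.sum fun k _ => (H.smoothOn_inv j k).mul
    ((((ContDiffOn.sum fun i _ => hp _ _ _ _).sub (ContDiffOn.sum fun i _ => hp _ _ _ _)).add
      (ContDiffOn.sum fun i _ => ContDiffOn.sum fun l _ =>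
        (H.smoothOn_Chr _ _ _).mul (H.smoothOn_Chr _ _ _))).sub
      (ContDiffOn.sum fun i _ => ContDiffOn.sum fun l _ =>
        (H.smoothOn_Chr _ _ _).mul (H.smoothOn_Chr _ _ _)))

theorem inv_mul_self (H : Cone Ω β h) {y : Eu 2} (hy : y ∈ Ω) : (β y)⁻¹ * β y = 1 :=
  Matrix.nonsing_inv_mul _ (isUnit_iff_ne_zero.2 (H.det_pos hy).ne')

theorem inv_symm (H : Cone Ω β h) {y : Eu 2} (hy : y ∈ Ω) (i j : Fin 2) :
    (β y)⁻¹ i j = (β y)⁻¹ j i := by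
  have : Matrix.transpose (β y)⁻¹ = (β y)⁻¹ := by rw [Matrix.transpose_nonsing_inv, H.symm y hy]
  exact congrFun (congrFun this j) i

theorem inv_eq (H : Cone Ω β h) {x : Eu 3} (hx : x ∈ Mset Ω) :
    (h x)⁻¹ 0 0 = 1 ∧ (∀ i : Fin 2, (h x)⁻¹ 0 i.succ = 0 ∧ (h x)⁻¹ i.succ 0 = 0) ∧
      ∀ i j : Fin 2, (h x)⁻¹ i.succ j.succ = ((x 0) ^ 2)⁻¹ * (β (pr32 x))⁻¹ i j := by
  obtain ⟨h00, h0, hij⟩ := H.wrap x hx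
  have hr : x 0 ≠ 0 := hx.1.ne'
  let g : Matrix (Fin 3) (Fin 3) ℝ := Matrix.of
    (Fin.cons (Fin.cons 1 fun _ => 0) fun i => Fin.cons 0 fun j =>
      ((x 0) ^ 2)⁻¹ * (β (pr32 x))⁻¹ i j)
  have hg : (h x)⁻¹ = g := by
    refine Matrix.inv_eq_left_inv ?_
    have hb := H.inv_mul_self hx.2
    ext i j
    rw [Matrix.mul_apply, Fin.sum_univ_succ]
    refine Fin.cases ?_ (fun i => ?_) i <;> refine Fin.cases ?_ (fun j => ?_) j
    · simp [g, h00]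
    · simp [g, (h0 _).1, (Fin.succ_ne_zero j).symm]
    · simp [g, (h0 _).2]
    · have hbij := congrFun (congrFun hb i) j
      rw [Matrix.mul_apply] at hbij
      simp only [g, hij, Matrix.of_apply, Fin.cons_succ, Fin.cons_zero, zero_mul, zero_add]
      rw [show (1 : Matrix (Fin 3) (Fin 3) ℝ) i.succ j.succ = (1 : Matrix (Fin 2) (Fin 2) ℝ) i j by
        simp [Matrix.one_apply], ← hbij]
      refine Finset.sum_congr rfl fun k _ => ?_
      field_simp
  rw [hg]
  exact ⟨rfl, fun i => ⟨rfl, rfl⟩, fun i j => rfl⟩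

theorem sdet_eq (H : Cone Ω β h) {x : Eu 3} (hx : x ∈ Mset Ω) :
    sdet h x = (x 0) ^ 2 * sdet β (pr32 x) := by
  obtain ⟨h00, h0, hij⟩ := H.wrap x hx
  have a := (h0 0).1
  have b := (h0 1).1
  have c := (h0 0).2
  have d := (h0 1).2
  have e := hij 0 0
  have f := hij 0 1
  have g := hij 1 0
  have k := hij 1 1
  simp only [Fin.succ_zero_eq_one, Fin.succ_one_eq_two] at a b c d e f g k
  have : (h x).det = ((x 0) ^ 2) ^ 2 * (β (pr32 x)).det := by
    rw [Matrix.det_fin_three, Matrix.det_fin_two, h00, a, b, c, d, e, f, g, k]; ring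
  unfold sdet
  rw [this, Real.sqrt_mul (by positivity), Real.sqrt_sq (by positivity)]

theorem sdet_M_pos (H : Cone Ω β h) {x : Eu 3} (hx : x ∈ Mset Ω) : 0 < sdet h x := by
  rw [H.sdet_eq hx]
  exact mul_pos (pow_pos hx.1 2) (H.sdet_pos hx.2)

theorem smoothOn_sdet_M (H : Cone Ω β h) : SmoothOn (Mset Ω) (sdet h) := by
  have : SmoothOn (Mset Ω) fun x => (x 0) ^ 2 * sdet β (pr32 x) :=
    (smoothOn_radial (m := fun r => r ^ 2) (by fun_prop)).mul (smoothOn_comp_pr32 H.smoothOn_sdet)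
  exact this.congr fun x hx => H.sdet_eq hx

theorem smoothOn_inv_M (H : Cone Ω β h) (i j : Fin 3) :
    SmoothOn (Mset Ω) fun x => (h x)⁻¹ i j := by
  refine Fin.cases ?_ (fun i => ?_) i <;> refine Fin.cases ?_ (fun j => ?_) j
  · exact contDiffOn_const.congr fun x hx => (H.inv_eq hx).1
  · exact contDiffOn_const.congr fun x hx => ((H.inv_eq hx).2.1 j).1
  · exact contDiffOn_const.congr fun x hx => ((H.inv_eq hx).2.1 i).2
  · have : SmoothOn (Mset Ω) fun x => ((x 0) ^ 2)⁻¹ * (β (pr32 x))⁻¹ i j :=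
      (smoothOn_radial (m := fun r => (r ^ 2)⁻¹)
        (ContDiffOn.inv (by fun_prop) fun r hr => by simp at hr; positivity)).mul
        (smoothOn_comp_pr32 (H.smoothOn_inv i j))
    exact this.congr fun x hx => (H.inv_eq hx).2.2 i j

end Cone
end cone

section curvature
variable {Ω : Set (Eu 2)} {β : Eu 2 → Matrix (Fin 2) (Fin 2) ℝ}
  {h : Eu 3 → Matrix (Fin 3) (Fin 3) ℝ}

namespace Cone

theorem pd_entry_zero_zero (H : Cone Ω β h) {x : Eu 3} (hx : x ∈ Mset Ω) (a : Fin 3) :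
    pd a (fun y => h y 0 0) x = 0 := by
  rw [pd_congr H.isOpen_M (g := fun _ => (1 : ℝ)) (fun y hy => (H.wrap y hy).1) hx, pd_const]

theorem pd_entry_zero_succ (H : Cone Ω β h) {x : Eu 3} (hx : x ∈ Mset Ω) (a : Fin 3)
    (i : Fin 2) : pd a (fun y => h y 0 i.succ) x = 0 := by
  rw [pd_congr H.isOpen_M (g := fun _ => (0 : ℝ)) (fun y hy => ((H.wrap y hy).2.1 i).1) hx,
    pd_const]

theorem pd_entry_succ_zero (H : Cone Ω β h) {x : Eu 3} (hx : x ∈ Mset Ω) (a : Fin 3)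
    (i : Fin 2) : pd a (fun y => h y i.succ 0) x = 0 := by
  rw [pd_congr H.isOpen_M (g := fun _ => (0 : ℝ)) (fun y hy => ((H.wrap y hy).2.1 i).2) hx,
    pd_const]

theorem diffAt_entry (H : Cone Ω β h) {y : Eu 2} (hy : y ∈ Ω) (i j : Fin 2) :
    DifferentiableAt ℝ (fun y => β y i j) y := (H.smooth i j).diffAt H.isOpen hy

/-- Derivatives of products `m(r) g(y)`. -/
theorem pd_zero_radial_mul {m : ℝ → ℝ} {m' : ℝ} {g : Eu 2 → ℝ} {x : Eu 3}
    (hm : HasDerivAt m m' (x 0)) (hg : DifferentiableAt ℝ g (pr32 x)) :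
    pd 0 (fun y : Eu 3 => m (y 0) * g (pr32 y)) x = m' * g (pr32 x) := by
  rw [pd_mul (hasFDerivAt_radial hm).differentiableAt, pd_zero_comp_pr32 hg, pd_zero_radial hm]
  · ring
  · exact hg.comp (f := pr32L) x pr32L.differentiableAt

theorem pd_succ_radial_mul {m : ℝ → ℝ} {m' : ℝ} {g : Eu 2 → ℝ} {x : Eu 3}
    (hm : HasDerivAt m m' (x 0)) (hg : DifferentiableAt ℝ g (pr32 x)) (j : Fin 2) :
    pd j.succ (fun y : Eu 3 => m (y 0) * g (pr32 y)) x = m (x 0) * pd j g (pr32 x) := by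
  rw [pd_mul (hasFDerivAt_radial hm).differentiableAt, pd_succ_comp_pr32 hg, pd_succ_radial hm]
  · ring
  · exact hg.comp (f := pr32L) x pr32L.differentiableAt

theorem pd_zero_entry (H : Cone Ω β h) {x : Eu 3} (hx : x ∈ Mset Ω) (i j : Fin 2) :
    pd 0 (fun y => h y i.succ j.succ) x = 2 * x 0 * β (pr32 x) i j := by
  rw [pd_congr H.isOpen_M (fun y hy => (H.wrap y hy).2.2 i j) hx]
  exact pd_zero_radial_mul (m := fun r => r ^ 2) (by simpa using hasDerivAt_pow 2 (x 0))
    (H.diffAt_entry hx.2 i j)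

theorem pd_succ_entry (H : Cone Ω β h) {x : Eu 3} (hx : x ∈ Mset Ω) (a i j : Fin 2) :
    pd a.succ (fun y => h y i.succ j.succ) x
      = (x 0) ^ 2 * pd a (fun y => β y i j) (pr32 x) := by
  rw [pd_congr H.isOpen_M (fun y hy => (H.wrap y hy).2.2 i j) hx]
  exact pd_succ_radial_mul (m := fun r => r ^ 2) (hasDerivAt_pow 2 (x 0))
    (H.diffAt_entry hx.2 i j) a

theorem inv_mul_apply (H : Cone Ω β h) {y : Eu 2} (hy : y ∈ Ω) (i j : Fin 2) :
    ∑ l, (β y)⁻¹ i l * β y l j = if i = j then 1 else 0 := by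
  rw [← Matrix.mul_apply, H.inv_mul_self hy, Matrix.one_apply]

theorem symm_apply (H : Cone Ω β h) {y : Eu 2} (hy : y ∈ Ω) (i j : Fin 2) :
    β y i j = β y j i := congrFun (congrFun (H.symm y hy).symm i) j

theorem Chr_zero_zero (H : Cone Ω β h) {x : Eu 3} (hx : x ∈ Mset Ω) (i : Fin 3) :
    Chr h i 0 0 x = 0 := by
  unfold Chr
  rw [Fin.sum_univ_succ]
  simp [H.pd_entry_zero_zero hx, H.pd_entry_succ_zero hx, H.pd_entry_zero_succ hx]

theorem Chr_zero_zero_succ (H : Cone Ω β h) {x : Eu 3} (hx : x ∈ Mset Ω) (k : Fin 2) :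
    Chr h 0 0 k.succ x = 0 ∧ Chr h 0 k.succ 0 x = 0 := by
  unfold Chr
  simp_rw [Fin.sum_univ_succ (n := 2)]
  simp [-Fin.sum_univ_two, H.pd_entry_zero_zero hx, H.pd_entry_succ_zero hx,
    H.pd_entry_zero_succ hx, (H.inv_eq hx).2.1]

theorem Chr_zero_succ_succ (H : Cone Ω β h) {x : Eu 3} (hx : x ∈ Mset Ω) (j k : Fin 2) :
    Chr h 0 j.succ k.succ x = -(x 0 * β (pr32 x) j k) := by
  unfold Chr
  rw [Fin.sum_univ_succ]
  simp only [H.pd_entry_succ_zero hx, H.pd_entry_zero_succ hx,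
    H.inv_eq hx, H.pd_zero_entry hx, zero_mul, Finset.sum_const_zero]
  ring

theorem Chr_succ_zero_succ (H : Cone Ω β h) {x : Eu 3} (hx : x ∈ Mset Ω) (i k : Fin 2) :
    Chr h i.succ 0 k.succ x = (if i = k then 1 else 0) / x 0 ∧
      Chr h i.succ k.succ 0 x = (if i = k then 1 else 0) / x 0 := by
  have hr : x 0 ≠ 0 := hx.1.ne'
  unfold Chr
  simp_rw [Fin.sum_univ_succ (n := 2)]
  simp only [H.pd_entry_succ_zero hx, H.pd_entry_zero_succ hx,
    H.inv_eq hx, H.pd_zero_entry hx, zero_mul, zero_add, ← H.inv_mul_apply hx.2, add_zero, sub_zero]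
  constructor
  · rw [Finset.mul_sum, Finset.sum_div]
    refine Finset.sum_congr rfl fun l _ => ?_
    field_simp
  · rw [Finset.mul_sum, Finset.sum_div]
    refine Finset.sum_congr rfl fun l _ => ?_
    rw [H.symm_apply hx.2 k l]
    field_simp

theorem Chr_succ (H : Cone Ω β h) {x : Eu 3} (hx : x ∈ Mset Ω) (i j k : Fin 2) :
    Chr h i.succ j.succ k.succ x = Chr β i j k (pr32 x) := by
  have hr : x 0 ≠ 0 := hx.1.ne'
  unfold Chr
  rw [Fin.sum_univ_succ]
  simp only [H.inv_eq hx, H.pd_succ_entry hx, zero_mul, zero_add]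
  congr 1
  refine Finset.sum_congr rfl fun l _ => ?_
  field_simp

theorem pd_zero_div (x : Eu 3) (c : ℝ) (hr : x 0 ≠ 0) :
    pd 0 (fun y : Eu 3 => c / y 0) x = -(c / (x 0) ^ 2) := by
  refine pd_zero_radial (m := fun r => c / r) ?_
  simpa [div_eq_mul_inv] using! (hasDerivAt_inv hr).const_mul c

theorem pd_succ_div (x : Eu 3) (c : ℝ) (hr : x 0 ≠ 0) (j : Fin 2) :
    pd j.succ (fun y : Eu 3 => c / y 0) x = 0 :=
  pd_succ_radial (m := fun r => c / r) (by
    simpa [div_eq_mul_inv] using! (hasDerivAt_inv hr).const_mul c) j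

/-- The scalar curvature of `dr² + r² β`. -/
theorem Rscal_eq (H : Cone Ω β h) {x : Eu 3} (hx : x ∈ Mset Ω) :
    Rscal h x = ((x 0) ^ 2)⁻¹ * (Rscal β (pr32 x) - 2) := by
  have hr : x 0 ≠ 0 := hx.1.ne'
  have hM := H.isOpen_M
  have dc : ∀ i j k, DifferentiableAt ℝ (Chr β i j k) (pr32 x) := fun i j k =>
    (H.smoothOn_Chr i j k).diffAt H.isOpen hx.2
  have p1 : ∀ (a i : Fin 3), pd a (fun y => Chr h i 0 0 y) x = 0 := fun a i => by
    rw [pd_congr hM (g := fun _ => (0 : ℝ)) (fun y hy => H.Chr_zero_zero hy i) hx, pd_const]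
  have p2 : ∀ (a : Fin 3) (k : Fin 2), pd a (fun y => Chr h 0 0 k.succ y) x = 0 := fun a k => by
    rw [pd_congr hM (g := fun _ => (0 : ℝ)) (fun y hy => (H.Chr_zero_zero_succ hy k).1) hx,
      pd_const]
  have p3 : ∀ (a : Fin 3) (k : Fin 2), pd a (fun y => Chr h 0 k.succ 0 y) x = 0 := fun a k => by
    rw [pd_congr hM (g := fun _ => (0 : ℝ)) (fun y hy => (H.Chr_zero_zero_succ hy k).2) hx,
      pd_const]
  have p4 : ∀ j k : Fin 2, pd 0 (fun y => Chr h 0 j.succ k.succ y) x = - β (pr32 x) j k :=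
    fun j k => by
      rw [pd_congr hM (g := fun y => (fun r => -r) (y 0) * (fun y => β y j k) (pr32 y))
        (fun y hy => by rw [H.Chr_zero_succ_succ hy]; ring) hx,
        pd_zero_radial_mul (m := fun r => -r) (hasDerivAt_neg _) (H.diffAt_entry hx.2 j k)]
      ring
  have p5 : ∀ i k : Fin 2, pd 0 (fun y => Chr h i.succ 0 k.succ y) x
      = -((if i = k then 1 else 0) / (x 0) ^ 2) := fun i k => by
    rw [pd_congr hM (fun y hy => (H.Chr_succ_zero_succ hy i k).1) hx, pd_zero_div x _ hr]
  have p5' : ∀ a i k : Fin 2, pd a.succ (fun y => Chr h i.succ 0 k.succ y) x = 0 := fun a i k => by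
    rw [pd_congr hM (fun y hy => (H.Chr_succ_zero_succ hy i k).1) hx, pd_succ_div x _ hr]
  have p7 : ∀ a i j k : Fin 2, pd a.succ (fun y => Chr h i.succ j.succ k.succ y) x
      = pd a (fun y => Chr β i j k y) (pr32 x) := fun a i j k => by
    rw [pd_congr hM (fun y hy => H.Chr_succ hy i j k) hx, pd_succ_comp_pr32 (dc i j k)]
  unfold Rscal
  have e1 := H.inv_mul_apply hx.2 0 0
  have e2 := H.inv_mul_apply hx.2 1 1
  have s1 := H.symm_apply hx.2 0 1
  simp only [Fin.sum_univ_two, if_true] at e1 e2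
  simp only [Fin.sum_univ_succ (n := 2), H.inv_eq hx, p1, p2, p3, p4, p5, p5', p7,
    H.Chr_zero_zero hx, H.Chr_zero_zero_succ hx, H.Chr_zero_succ_succ hx,
    H.Chr_succ_zero_succ hx, H.Chr_succ hx]
  simp only [Fin.sum_univ_two, if_true, Fin.isValue, zero_ne_one, one_ne_zero, if_false]
  set r := x 0
  generalize (β (pr32 x))⁻¹ = g at *
  generalize β (pr32 x) = b at *
  generalize (fun i j k => Chr β i j k (pr32 x)) = Λ at *
  rw [s1] at *
  field_simp
  linear_combination (-1) * e1 - e2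
end Cone
end curvature

/-- The weight `(1+r)^{-(1+2η)}`. -/
def wt (η r : ℝ) : ℝ := (1 + r) ^ (-(1 + 2 * η))

/-- The radial multiplier, a bounded primitive of `wt η`. -/
def mul1 (η r : ℝ) : ℝ := (2 - (1 + r) ^ (-(2 * η))) / (2 * η)

/-- Half of the divergence of the radial field `mul1 η ∂_r` in the cone metric. -/
def mul0 (η r : ℝ) : ℝ := wt η r / 2 + mul1 η r / r

section weights
variable {η r : ℝ}

theorem wt_pos (hr : 0 < r) : 0 < wt η r := Real.rpow_pos_of_pos (by linarith) _

theorem hasDerivAt_wt (hr : 0 < r) :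
    HasDerivAt (wt η) (-(1 + 2 * η) * wt η r / (1 + r)) r := by
  have h1 : HasDerivAt (fun r : ℝ => 1 + r) 1 r := by
    simpa using (hasDerivAt_id r).const_add 1
  have hs : (1 + r : ℝ) ≠ 0 := by positivity
  have := h1.rpow_const (p := -(1 + 2 * η)) (Or.inl hs)
  unfold wt
  convert this using 1
  rw [Real.rpow_sub_one hs]; ring

theorem hasDerivAt_mul1 (hη : 0 < η) (hr : 0 < r) : HasDerivAt (mul1 η) (wt η r) r := by
  have h1 : HasDerivAt (fun r : ℝ => 1 + r) 1 r := by
    simpa using (hasDerivAt_id r).const_add 1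
  have hs : (1 + r : ℝ) ≠ 0 := by positivity
  have := ((h1.rpow_const (p := -(2 * η)) (Or.inl hs)).const_sub 2).div_const (2 * η)
  unfold mul1 wt
  refine this.congr_deriv ?_
  rw [show -(1 + 2 * η) = -(2 * η) - 1 by ring]
  field_simp

theorem hasDerivAt_mul0 (hη : 0 < η) (hr : 0 < r) :
    HasDerivAt (mul0 η) (-(1 + 2 * η) * wt η r / (1 + r) / 2 + wt η r / r - mul1 η r / r ^ 2) r := by
  have := ((hasDerivAt_wt (η := η) hr).div_const 2).add
    ((hasDerivAt_mul1 hη hr).div (hasDerivAt_id r) hr.ne')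
  refine this.congr_deriv ?_
  simp only [id]
  field_simp
  ring

theorem contDiffOn_wt : ContDiffOn ℝ (⊤ : ℕ∞) (wt η) (Ioi 0) := by
  unfold wt
  refine ContDiffOn.rpow_const_of_ne (by fun_prop) fun r hr => ?_
  rw [mem_Ioi] at hr; positivity

theorem contDiffOn_mul1 : ContDiffOn ℝ (⊤ : ℕ∞) (mul1 η) (Ioi 0) := by
  unfold mul1
  refine (contDiffOn_const.sub (ContDiffOn.rpow_const_of_ne (by fun_prop) fun r hr => ?_)).div_const _
  rw [mem_Ioi] at hr; positivity

theorem contDiffOn_mul0 : ContDiffOn ℝ (⊤ : ℕ∞) (mul0 η) (Ioi 0) := by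
  unfold mul0
  exact (contDiffOn_wt.div_const _).add
    (contDiffOn_mul1.div contDiffOn_id fun r hr => (mem_Ioi.1 hr).ne.symm)

theorem mul1_bounds (hη : 0 < η) (hr : 0 < r) : 1 / (2 * η) ≤ mul1 η r ∧ mul1 η r ≤ 1 / η := by
  have h1 : (1 + r : ℝ) ^ (-(2 * η)) ≤ 1 :=
    Real.rpow_le_one_of_one_le_of_nonpos (by linarith) (by linarith)
  have h2 : 0 < (1 + r : ℝ) ^ (-(2 * η)) := Real.rpow_pos_of_pos (by linarith) _
  unfold mul1
  constructor
  · gcongr; linarith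
  · rw [div_le_div_iff₀ (by positivity) hη]; nlinarith

theorem mul_wt_le_one (hη : 0 < η) (hr : 0 < r) : r * wt η r ≤ 1 := by
  have h1 : wt η r ≤ (1 + r) ^ (-1 : ℝ) :=
    Real.rpow_le_rpow_of_exponent_le (by linarith) (by linarith)
  rw [Real.rpow_neg_one] at h1
  calc r * wt η r ≤ r * (1 + r)⁻¹ := by gcongr
    _ ≤ 1 := by rw [← div_eq_mul_inv, div_le_one (by linarith)]; linarith

theorem rpow_neg_le_of_le {p p' : ℝ} (hp : 0 < p) (hpp : p ≤ p') (hr : 0 < r) :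
    (1 + r ^ 2) ^ (-p') ≤ 2 ^ p * (1 + r) ^ (-(2 * p)) := by
  have h0 : (1 : ℝ) ≤ 1 + r ^ 2 := by nlinarith
  calc (1 + r ^ 2) ^ (-p') ≤ (1 + r ^ 2) ^ (-p) :=
        Real.rpow_le_rpow_of_exponent_le h0 (by linarith)
    _ ≤ ((1 + r) ^ 2 / 2) ^ (-p) :=
        Real.rpow_le_rpow_of_nonpos (by positivity) (by nlinarith [sq_nonneg (1 - r)]) (by linarith)
    _ = 2 ^ p * (1 + r) ^ (-(2 * p)) := by
        rw [Real.div_rpow (by positivity) (by norm_num), Real.rpow_neg (by norm_num : (0 : ℝ) ≤ 2),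
          ← Real.rpow_natCast (1 + r) 2, ← Real.rpow_mul (by linarith)]
        push_cast
        rw [show 2 * -p = -(2 * p) by ring, div_inv_eq_mul, mul_comm]

theorem weight_grad_le {η₂ : ℝ} (hη : 0 < η) (h2 : η ≤ η₂) (hr : 0 < r) :
    (1 + r ^ 2) ^ (-(1 / 2 + η₂)) ≤ 2 ^ (1 / 2 + η) * wt η r := by
  have := rpow_neg_le_of_le (p := 1 / 2 + η) (p' := 1 / 2 + η₂) (by linarith) (by linarith) hr
  unfold wt
  convert this using 4; ring

theorem weight_zero_le {η₁ : ℝ} (hη : 0 < η) (h1 : η ≤ η₁) (hr : 0 < r) :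
    (1 + r ^ 2) ^ (-(3 / 2 + η₁)) ≤ 2 ^ (3 / 2 + η) * (wt η r / (1 + r) ^ 2) := by
  have := rpow_neg_le_of_le (p := 3 / 2 + η) (p' := 3 / 2 + η₁) (by linarith) (by linarith) hr
  unfold wt
  convert this using 2
  rw [← Real.rpow_natCast (1 + r) 2, ← Real.rpow_sub (by linarith)]
  congr 1; push_cast; ring

end weights

/-- `h^{ij} ∂_i f ∂_j g`. -/
def gradR (h : Eu 3 → Matrix (Fin 3) (Fin 3) ℝ) (f g : Eu 3 → ℝ) (x : Eu 3) : ℝ :=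
  ∑ i, ∑ j, (h x)⁻¹ i j * (pd i f x * pd j g x)

/-- The antisymmetric multiplier `mul1 ∂_r + mul0`. -/
def Xop {F : Type*} [NormedAddCommGroup F] [NormedSpace ℝ F] (η : ℝ) (f : Eu 3 → F) (x : Eu 3) :
    F := mul1 η (x 0) • pd 0 f x + mul0 η (x 0) • f x

/-- The tangential form `β^{ij} ∂_i f ∂_j f`. -/
def tanSq (β : Eu 2 → Matrix (Fin 2) (Fin 2) ℝ) (f : Eu 3 → ℝ) (x : Eu 3) : ℝ :=
  ∑ i : Fin 2, ∑ j : Fin 2, (β (pr32 x))⁻¹ i j * (pd i.succ f x * pd j.succ f x)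

theorem integral_eq_of_eq_add_div {n : ℕ} {M : Set (Eu n)} {P Q : Eu n → ℝ} {f : Fin n → Eu n → ℝ}
    (hM : IsOpen M) (hQ : IntegrableOn Q M) (hf : ∀ j, CS M (f j))
    (h : ∀ x ∈ M, P x = Q x + ∑ j, pd j (f j) x) : ∫ x in M, P x = ∫ x in M, Q x := by
  have h1 : ∀ j, IntegrableOn (pd j (f j)) M := fun j =>
    (((hf j).pderiv hM j).integrable hM).integrableOn
  rw [setIntegral_congr_fun hM.measurableSet h, integral_add hQ
    (integrable_finsetSum _ fun j _ => h1 j), integral_finsetSum _ fun j _ => h1 j]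
  simp [(hf _).integral_pd hM]

section spatial
variable {Ω : Set (Eu 2)} {β : Eu 2 → Matrix (Fin 2) (Fin 2) ℝ}
  {h : Eu 3 → Matrix (Fin 3) (Fin 3) ℝ} {η : ℝ}

theorem CS.Xop {F : Type*} [NormedAddCommGroup F] [NormedSpace ℝ F] {f : Eu 3 → F}
    (hf : CS (Mset Ω) f) (hΩ : IsOpen Ω) : CS (Mset Ω) (Xop η f) :=
  ((hf.pderiv (isOpen_Mset hΩ) 0).smul_left (smoothOn_radial contDiffOn_mul1)).add
    (hf.smul_left (smoothOn_radial contDiffOn_mul0))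

namespace Cone

theorem lapR_eq (H : Cone Ω β h) {f : Eu 3 → ℝ} {x : Eu 3} (hx : x ∈ Mset Ω) :
    lapR h f x * sdet h x
      = ∑ j, pd j (fun y => sdet h y * ∑ k, (h y)⁻¹ j k * pd k f y) x := by
  unfold lapR
  have := (H.sdet_M_pos hx).ne'
  field_simp

theorem integrableOn_CS (H : Cone Ω β h) {f : Eu 3 → ℝ} (hf : CS (Mset Ω) f) :
    IntegrableOn f (Mset Ω) := (hf.integrable H.isOpen_M).integrableOn

theorem CS_gradR (H : Cone Ω β h) {f g : Eu 3 → ℝ} (hf : CS (Mset Ω) f) (hg : CS (Mset Ω) g) :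
    CS (Mset Ω) fun x => gradR h f g x * sdet h x := by
  refine CS.mul_right ?_ H.smoothOn_sdet_M
  exact CS.sum _ fun i _ => CS.sum _ fun j _ =>
    ((hf.pderiv H.isOpen_M i).mul_right (hg.pderiv H.isOpen_M j).1).mul_left (H.smoothOn_inv_M i j)

theorem CS_flux (H : Cone Ω β h) {f : Eu 3 → ℝ} (hf : CS (Mset Ω) f) (j : Fin 3) :
    CS (Mset Ω) fun y => sdet h y * ∑ k, (h y)⁻¹ j k * pd k f y :=
  CS.mul_left (CS.sum _ fun k _ => (hf.pderiv H.isOpen_M k).mul_left (H.smoothOn_inv_M j k))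
    H.smoothOn_sdet_M

/-- Green's formula. -/
theorem green (H : Cone Ω β h) {f g : Eu 3 → ℝ} (hf : CS (Mset Ω) f) (hg : CS (Mset Ω) g) :
    ∫ x in Mset Ω, lapR h f x * g x * sdet h x = - ∫ x in Mset Ω, gradR h g f x * sdet h x := by
  rw [← integral_neg]
  have hM := H.isOpen_M
  have hV := fun j => (H.CS_flux hf j)
  refine integral_eq_of_eq_add_div hM (H.integrableOn_CS (H.CS_gradR hg hf)).neg
    (f := fun j x => (sdet h x * ∑ k, (h x)⁻¹ j k * pd k f x) * g x)
    (fun j => (hV j).mul_right hg.1) fun x hx => ?_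
  rw [show lapR h f x * g x * sdet h x = lapR h f x * sdet h x * g x by ring, H.lapR_eq hx,
    Finset.sum_congr rfl fun j _ => pd_mul ((hV j).1.diffAt hM hx) (hg.1.diffAt hM hx) j,
    Finset.sum_add_distrib, Finset.sum_mul]
  have : gradR h g f x * sdet h x
      = ∑ j, (sdet h x * ∑ k, (h x)⁻¹ j k * pd k f x) * pd j g x := by
    simp only [gradR, Finset.sum_mul, Finset.mul_sum]
    refine Finset.sum_congr rfl fun i _ => Finset.sum_congr rfl fun j _ => by ring
  rw [this]; ring

theorem gradR_eq (H : Cone Ω β h) (f g : Eu 3 → ℝ) {x : Eu 3} (hx : x ∈ Mset Ω) :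
    gradR h f g x * sdet h x = sdet β (pr32 x) * ((x 0) ^ 2 * (pd 0 f x * pd 0 g x)
      + ∑ i : Fin 2, ∑ j : Fin 2, (β (pr32 x))⁻¹ i j * (pd i.succ f x * pd j.succ g x)) := by
  have hr : x 0 ≠ 0 := hx.1.ne'
  unfold gradR
  simp only [Fin.sum_univ_succ (n := 2), H.inv_eq hx, H.sdet_eq hx]
  simp only [Fin.sum_univ_two]
  field_simp
  ring

theorem tanSq_nonneg (H : Cone Ω β h) (f : Eu 3 → ℝ) {x : Eu 3} (hx : x ∈ Mset Ω) :
    0 ≤ tanSq β f x := by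
  have h1 := (H.posDef _ hx.2).inv.posSemidef
  have h2 := h1.dotProduct_mulVec_nonneg (fun i => pd i.succ f x)
  refine h2.trans_eq ?_
  simp only [tanSq, dotProduct, Matrix.mulVec, Fin.sum_univ_two]
  simp
  ring

theorem CS_tanSq (H : Cone Ω β h) {f : Eu 3 → ℝ} (hf : CS (Mset Ω) f) :
    CS (Mset Ω) (tanSq β f) :=
  CS.sum _ fun i _ => CS.sum _ fun j _ => ((hf.pderiv H.isOpen_M i.succ).mul_right
    (hf.pderiv H.isOpen_M j.succ).1).mul_left (smoothOn_comp_pr32 (H.smoothOn_inv i j))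

/-- Products `k(y) m(r) E` with the derivative in `r`. -/
theorem CS_block {k : Eu 2 → ℝ} {m : ℝ → ℝ} {E : Eu 3 → ℝ}
    (hk : SmoothOn Ω k) (hm : ContDiffOn ℝ (⊤ : ℕ∞) m (Ioi 0)) (hE : CS (Mset Ω) E) :
    CS (Mset Ω) fun x => k (pr32 x) * (m (x 0) * E x) :=
  (hE.mul_left (smoothOn_radial hm)).mul_left (smoothOn_comp_pr32 hk)

theorem pd_block (H : Cone Ω β h) {k : Eu 2 → ℝ} {m : ℝ → ℝ} {m' : ℝ} {E : Eu 3 → ℝ} {x : Eu 3}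
    (hx : x ∈ Mset Ω) (hk : SmoothOn Ω k) (hm : HasDerivAt m m' (x 0)) (hE : SmoothOn (Mset Ω) E) :
    pd 0 (fun x => k (pr32 x) * (m (x 0) * E x)) x
      = k (pr32 x) * (m' * E x + m (x 0) * pd 0 E x) := by
  have d1 : DifferentiableAt ℝ (fun x : Eu 3 => m (x 0)) x :=
    (hasFDerivAt_radial hm).differentiableAt
  have d2 := hE.diffAt H.isOpen_M hx
  have d3 := hk.diffAt H.isOpen hx.2
  have d4 : DifferentiableAt ℝ (fun x : Eu 3 => k (pr32 x)) x :=
    d3.comp (f := pr32L) x pr32L.differentiableAt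
  rw [pd_mul d4 (d1.fun_mul d2), pd_zero_comp_pr32 d3, pd_mul d1 d2, pd_zero_radial hm]
  ring

theorem pd_Xop_zero (H : Cone Ω β h) (hη : 0 < η) {f : Eu 3 → ℝ} (hf : CS (Mset Ω) f) {x : Eu 3}
    (hx : x ∈ Mset Ω) : pd 0 (Xop η f) x = wt η (x 0) * pd 0 f x + mul1 η (x 0) * pd 0 (pd 0 f) x
      + (-(1 + 2 * η) * wt η (x 0) / (1 + x 0) / 2 + wt η (x 0) / x 0 - mul1 η (x 0) / (x 0) ^ 2) * f x
      + mul0 η (x 0) * pd 0 f x := by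
  have hM := H.isOpen_M
  have d1 := hasDerivAt_mul1 hη hx.1
  have d0 := hasDerivAt_mul0 hη hx.1
  have e1 := (hasFDerivAt_radial (x := x) d1).differentiableAt
  have e0 := (hasFDerivAt_radial (x := x) d0).differentiableAt
  have f0 := hf.1.diffAt hM hx
  have f1 := (hf.pderiv hM 0).1.diffAt hM hx
  unfold Xop
  simp only [smul_eq_mul]
  rw [pd_add (e1.fun_mul f1) (e0.fun_mul f0), pd_mul e1 f1, pd_mul e0 f0, pd_zero_radial d1,
    pd_zero_radial d0]
  ring

theorem pd_Xop_succ (H : Cone Ω β h) (hη : 0 < η) {f : Eu 3 → ℝ} (hf : CS (Mset Ω) f) {x : Eu 3}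
    (hx : x ∈ Mset Ω) (j : Fin 2) : pd j.succ (Xop η f) x
      = mul1 η (x 0) * pd 0 (pd j.succ f) x + mul0 η (x 0) * pd j.succ f x := by
  have hM := H.isOpen_M
  have d1 := hasDerivAt_mul1 hη hx.1
  have d0 := hasDerivAt_mul0 hη hx.1
  have e1 := (hasFDerivAt_radial (x := x) d1).differentiableAt
  have e0 := (hasFDerivAt_radial (x := x) d0).differentiableAt
  have f0 := hf.1.diffAt hM hx
  have f1 := (hf.pderiv hM 0).1.diffAt hM hx
  unfold Xop
  simp only [smul_eq_mul]
  rw [pd_add (e1.fun_mul f1) (e0.fun_mul f0), pd_mul e1 f1, pd_mul e0 f0, pd_succ_radial d1,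
    pd_succ_radial d0, pd_comm hf.1 hM hx]
  ring

theorem pd_sq (H : Cone Ω β h) {f : Eu 3 → ℝ} (hf : SmoothOn (Mset Ω) f) {x : Eu 3}
    (hx : x ∈ Mset Ω) : pd 0 (fun y => f y * f y) x = 2 * f x * pd 0 f x := by
  have d := hf.diffAt H.isOpen_M hx
  rw [pd_mul d d]; ring

theorem pd_tanSq (H : Cone Ω β h) {f : Eu 3 → ℝ} (hf : CS (Mset Ω) f) {x : Eu 3}
    (hx : x ∈ Mset Ω) : pd 0 (tanSq β f) x = 2 * ∑ i : Fin 2, ∑ j : Fin 2,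
      (β (pr32 x))⁻¹ i j * (pd 0 (pd i.succ f) x * pd j.succ f x) := by
  have hM := H.isOpen_M
  have hd : ∀ i, DifferentiableAt ℝ (pd i f) x := fun i => (hf.pderiv hM i).1.diffAt hM hx
  have hg : ∀ i j, DifferentiableAt ℝ (fun y => (β y)⁻¹ i j) (pr32 x) := fun i j =>
    (H.smoothOn_inv i j).diffAt H.isOpen hx.2
  have hg' : ∀ i j, DifferentiableAt ℝ (fun y => (β (pr32 y))⁻¹ i j) x := fun i j =>
    (hg i j).comp (f := pr32L) x pr32L.differentiableAt
  have key : ∀ i j : Fin 2,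
      pd 0 (fun x => (β (pr32 x))⁻¹ i j * (pd i.succ f x * pd j.succ f x)) x
        = (β (pr32 x))⁻¹ i j * (pd 0 (pd i.succ f) x * pd j.succ f x)
          + (β (pr32 x))⁻¹ j i * (pd 0 (pd j.succ f) x * pd i.succ f x) := fun i j => by
    rw [pd_mul (hg' i j) ((hd _).fun_mul (hd _)), pd_zero_comp_pr32 (hg i j), pd_mul (hd _) (hd _),
      H.inv_symm hx.2 j i]
    ring
  unfold tanSq
  have hD := fun i j : Fin 2 => (hg' i j).fun_mul ((hd i.succ).fun_mul (hd j.succ))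
  rw [pd_sum _ (fun i _ => DifferentiableAt.fun_sum fun j _ => hD i j),
    Finset.sum_congr rfl fun i _ => (pd_sum Finset.univ (fun j _ => hD i j) 0).trans
      (Finset.sum_congr rfl fun j _ => key i j)]
  simp only [Fin.sum_univ_two]
  ring

end Cone
end spatial

/-- The density controlled by the multiplier `Xop`, times the radial volume factor. -/
def morDens (β : Eu 2 → Matrix (Fin 2) (Fin 2) ℝ) (η : ℝ) (f : Eu 3 → ℝ) (x : Eu 3) : ℝ :=
  sdet β (pr32 x) * (1 / (4 * (1 + η)) * ((x 0) ^ 2 * wt η (x 0)) * (pd 0 f x * pd 0 f x)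
    + (1 + η) / 4 * ((x 0) ^ 2 * wt η (x 0) / (1 + x 0) ^ 2) * (f x * f x)
    + mul1 η (x 0) / x 0 * tanSq β f x)

/-- The coefficient of `f²` in `morFlux`. -/
def morMul (η r : ℝ) : ℝ :=
  1 / 2 * mul1 η r + (1 / 2 - 1 / (4 * (1 + η))) * (r * wt η r)
    + ((1 + 2 * η) / 4 - (1 - 1 / (4 * (1 + η))) * (1 + η)) * (r ^ 2 * wt η r / (1 + r))

/-- The radial flux relating `morDens` to the gradient form. -/
def morFlux (β : Eu 2 → Matrix (Fin 2) (Fin 2) ℝ) (η : ℝ) (f : Eu 3 → ℝ) (x : Eu 3) : ℝ :=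
  -(1 / 2) * (sdet β (pr32 x) * ((x 0) ^ 2 * mul1 η (x 0) * (pd 0 f x * pd 0 f x)))
    + sdet β (pr32 x) * (morMul η (x 0) * (f x * f x))
    + -(1 / 2) * (sdet β (pr32 x) * (mul1 η (x 0) * tanSq β f x))

section multiplier
variable {Ω : Set (Eu 2)} {β : Eu 2 → Matrix (Fin 2) (Fin 2) ℝ}
  {h : Eu 3 → Matrix (Fin 3) (Fin 3) ℝ} {η : ℝ}

theorem hasDerivAt_id_mul_wt {r : ℝ} (hr : 0 < r) :
    HasDerivAt (fun r => r * wt η r) (wt η r - (1 + 2 * η) * (r * wt η r) / (1 + r)) r := by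
  refine ((hasDerivAt_id r).mul (hasDerivAt_wt hr)).congr_deriv ?_
  simp only [id]; ring

theorem hasDerivAt_sq_mul_wt_div {r : ℝ} (hr : 0 < r) :
    HasDerivAt (fun r => r ^ 2 * wt η r / (1 + r))
      (2 * r * wt η r / (1 + r) - 2 * (1 + η) * (r ^ 2 * wt η r) / (1 + r) ^ 2) r := by
  have hs : 1 + r ≠ 0 := by positivity
  refine ((((hasDerivAt_id r).pow 2).mul (hasDerivAt_wt hr)).div
    ((hasDerivAt_id r).const_add 1) hs).congr_deriv ?_
  simp only [id, Pi.mul_apply, Pi.pow_apply]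
  field_simp
  ring

theorem hasDerivAt_sq_mul_mul1 {r : ℝ} (hη : 0 < η) (hr : 0 < r) :
    HasDerivAt (fun r => r ^ 2 * mul1 η r) (2 * r * mul1 η r + r ^ 2 * wt η r) r := by
  refine (((hasDerivAt_id r).pow 2).mul (hasDerivAt_mul1 hη hr)).congr_deriv ?_
  simp

theorem contDiffOn_sq_mul_mul1 : ContDiffOn ℝ (⊤ : ℕ∞) (fun r => r ^ 2 * mul1 η r) (Ioi 0) :=
  (contDiffOn_id.pow 2).mul contDiffOn_mul1

theorem contDiffOn_sq_mul_wt_div :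
    ContDiffOn ℝ (⊤ : ℕ∞) (fun r => r ^ 2 * wt η r / (1 + r)) (Ioi 0) :=
  ((contDiffOn_id.pow 2).mul contDiffOn_wt).div (contDiffOn_const.add contDiffOn_id)
    fun r hr => by simp only [mem_Ioi] at hr ⊢; positivity

namespace Cone

theorem CS_morDens (H : Cone Ω β h) {f : Eu 3 → ℝ} (hf : CS (Mset Ω) f) :
    CS (Mset Ω) (morDens β η f) := by
  have f1 := hf.pderiv H.isOpen_M 0
  refine CS.mul_left ?_ (smoothOn_comp_pr32 H.smoothOn_sdet)
  refine ((((f1.mul_right f1.1).mul_left ?_).add ((hf.mul_right hf.1).mul_left ?_)).add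
    ((H.CS_tanSq hf).mul_left ?_))
  · exact smoothOn_radial (m := fun r => 1 / (4 * (1 + η)) * (r ^ 2 * wt η r))
      (contDiffOn_const.mul ((contDiffOn_id.pow 2).mul contDiffOn_wt))
  · refine smoothOn_radial (m := fun r => (1 + η) / 4 * (r ^ 2 * wt η r / (1 + r) ^ 2))
      (contDiffOn_const.mul (((contDiffOn_id.pow 2).mul contDiffOn_wt).div
        ((contDiffOn_const.add contDiffOn_id).pow 2) fun r hr => ?_))
    simp only [mem_Ioi] at hr ⊢; positivity
  · exact smoothOn_radial (m := fun r => mul1 η r / r)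
      (contDiffOn_mul1.div contDiffOn_id fun r hr => (mem_Ioi.1 hr).ne.symm)

/-- `Xop` is antisymmetric. -/
theorem integral_mul_Xop (H : Cone Ω β h) (hη : 0 < η) {f : Eu 3 → ℝ} (hf : CS (Mset Ω) f) :
    ∫ x in Mset Ω, f x * Xop η f x * sdet h x = 0 := by
  have hG := CS_block H.smoothOn_sdet (contDiffOn_sq_mul_mul1 (η := η)) (hf.mul_right hf.1)
  have : ∀ x ∈ Mset Ω, f x * Xop η f x * sdet h x = 1 / 2 *
      pd 0 (fun x => sdet β (pr32 x) * ((x 0) ^ 2 * mul1 η (x 0) * (f x * f x))) x := by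
    intro x hx
    have hr : x 0 ≠ 0 := hx.1.ne'
    rw [H.pd_block hx H.smoothOn_sdet (hasDerivAt_sq_mul_mul1 hη hx.1) (hf.1.mul hf.1),
      H.pd_sq hf.1 hx, H.sdet_eq hx]
    simp only [Xop, mul0, smul_eq_mul]
    field_simp
    ring
  rw [setIntegral_congr_fun H.isOpen_M.measurableSet this, integral_const_mul,
    hG.integral_pd H.isOpen_M 0, mul_zero]

theorem CS_morFlux (H : Cone Ω β h) {f : Eu 3 → ℝ} (hf : CS (Mset Ω) f) :
    CS (Mset Ω) (morFlux β η f) := by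
  have f1 := hf.pderiv H.isOpen_M 0
  refine (((CS_block H.smoothOn_sdet contDiffOn_sq_mul_mul1 (f1.mul_right f1.1)).mul_left
    contDiffOn_const).add (CS_block H.smoothOn_sdet ?_ (hf.mul_right hf.1))).add
    ((CS_block H.smoothOn_sdet contDiffOn_mul1 (H.CS_tanSq hf)).mul_left contDiffOn_const)
  exact ((contDiffOn_const.mul contDiffOn_mul1).add
    (contDiffOn_const.mul (contDiffOn_id.mul contDiffOn_wt))).add
    (contDiffOn_const.mul contDiffOn_sq_mul_wt_div)

theorem pd_morFlux (H : Cone Ω β h) (hη : 0 < η) {f : Eu 3 → ℝ} (hf : CS (Mset Ω) f) {x : Eu 3}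
    (hx : x ∈ Mset Ω) : pd 0 (morFlux β η f) x = sdet β (pr32 x) * (
      -(1 / 2) * ((2 * x 0 * mul1 η (x 0) + (x 0) ^ 2 * wt η (x 0)) * (pd 0 f x * pd 0 f x)
        + (x 0) ^ 2 * mul1 η (x 0) * (2 * pd 0 f x * pd 0 (pd 0 f) x))
      + ((1 / 2 * wt η (x 0) + (1 / 2 - 1 / (4 * (1 + η))) *
            (wt η (x 0) - (1 + 2 * η) * (x 0 * wt η (x 0)) / (1 + x 0))
          + ((1 + 2 * η) / 4 - (1 - 1 / (4 * (1 + η))) * (1 + η)) *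
            (2 * x 0 * wt η (x 0) / (1 + x 0)
              - 2 * (1 + η) * ((x 0) ^ 2 * wt η (x 0)) / (1 + x 0) ^ 2)) * (f x * f x)
        + morMul η (x 0) * (2 * f x * pd 0 f x))
      + -(1 / 2) * (wt η (x 0) * tanSq β f x + mul1 η (x 0) * (2 * ∑ i : Fin 2, ∑ j : Fin 2,
        (β (pr32 x))⁻¹ i j * (pd 0 (pd i.succ f) x * pd j.succ f x)))) := by
  have hr : 0 < x 0 := hx.1
  have hM := H.isOpen_M
  have f1 := hf.pderiv hM 0
  have e2 : HasDerivAt (morMul η) _ (x 0) := (((hasDerivAt_mul1 hη hr).const_mul (1 / 2)).add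
    ((hasDerivAt_id_mul_wt (η := η) hr).const_mul (1 / 2 - 1 / (4 * (1 + η))))).add
    ((hasDerivAt_sq_mul_wt_div (η := η) hr).const_mul
      ((1 + 2 * η) / 4 - (1 - 1 / (4 * (1 + η))) * (1 + η)))
  have hm2 : ContDiffOn ℝ (⊤ : ℕ∞) (morMul η) (Ioi 0) :=
    ((contDiffOn_const.mul contDiffOn_mul1).add
      (contDiffOn_const.mul (contDiffOn_id.mul contDiffOn_wt))).add
      (contDiffOn_const.mul contDiffOn_sq_mul_wt_div)
  have c1 := (CS_block H.smoothOn_sdet (contDiffOn_sq_mul_mul1 (η := η))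
    (f1.mul_right f1.1)).1.diffAt hM hx
  have c2 := (CS_block H.smoothOn_sdet hm2 (hf.mul_right hf.1)).1.diffAt hM hx
  have c3 := (CS_block H.smoothOn_sdet (contDiffOn_mul1 (η := η)) (H.CS_tanSq hf)).1.diffAt hM hx
  have k : ∀ (g : Eu 3 → ℝ) (c : ℝ), DifferentiableAt ℝ g x →
      pd 0 (fun y => c * g y) x = c * pd 0 g x := fun g c hg => by
    rw [pd_mul (differentiableAt_const c) hg, pd_const, zero_mul, add_zero]
  unfold morFlux
  rw [pd_add ((c1.const_mul _).fun_add c2) (c3.const_mul _), pd_add (c1.const_mul _) c2,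
    k _ _ c1, k _ _ c3,
    H.pd_block hx H.smoothOn_sdet (hasDerivAt_sq_mul_mul1 hη hr) (f1.1.mul f1.1),
    H.pd_block hx H.smoothOn_sdet e2 (hf.1.mul hf.1),
    H.pd_block hx H.smoothOn_sdet (hasDerivAt_mul1 hη hr) (H.CS_tanSq hf).1,
    H.pd_sq hf.1 hx, H.pd_sq f1.1 hx, H.pd_tanSq hf hx]
  ring

theorem morDens_le (H : Cone Ω β h) (hη : 0 < η) {f : Eu 3 → ℝ} (hf : CS (Mset Ω) f) {x : Eu 3}
    (hx : x ∈ Mset Ω) : morDens β η f x ≤ gradR h (Xop η f) f x * sdet h x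
      + pd 0 (morFlux β η f) x := by
  have hr : 0 < x 0 := hx.1
  have hw := wt_pos (η := η) hr
  have hb := H.sdet_pos hx.2
  have hT : ∑ i : Fin 2, ∑ j : Fin 2, (β (pr32 x))⁻¹ i j * (pd i.succ (Xop η f) x * pd j.succ f x)
      = mul1 η (x 0) * ∑ i : Fin 2, ∑ j : Fin 2,
        (β (pr32 x))⁻¹ i j * (pd 0 (pd i.succ f) x * pd j.succ f x)
        + mul0 η (x 0) * tanSq β f x := by
    simp only [tanSq, H.pd_Xop_succ hη hf hx, Fin.sum_univ_two]
    ring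
  rw [H.gradR_eq _ _ hx, hT, H.pd_morFlux hη hf hx, H.pd_Xop_zero hη hf hx]
  generalize ∑ i : Fin 2, ∑ j : Fin 2, (β (pr32 x))⁻¹ i j * (pd 0 (pd i.succ f) x * pd j.succ f x) = T
  unfold morDens
  generalize tanSq β f x = q
  generalize pd 0 (pd 0 f) x = frr
  generalize pd 0 f x = fr
  generalize f x = f0
  unfold morMul mul0
  generalize sdet β (pr32 x) = b at *
  generalize wt η (x 0) = w at *
  generalize mul1 η (x 0) = ψ
  generalize x 0 = r at *
  have hd : 0 ≤ b * (w * ((1 - 1 / (4 * (1 + η))) * (r * fr + f0 - (1 + η) * (r / (1 + r)) * f0) ^ 2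
      + 1 / (4 * (1 + η)) * (1 + 2 * η) * (r / (1 + r)) * f0 ^ 2)) := by
    have : 1 / (4 * (1 + η)) ≤ 1 := by
      rw [div_le_one (by positivity)]; linarith
    have : 0 ≤ 1 - 1 / (4 * (1 + η)) := by linarith
    positivity
  refine le_of_sub_nonneg (hd.trans_eq ?_)
  have hs : 1 + r ≠ 0 := by positivity
  have he : 1 + η ≠ 0 := by positivity
  field_simp
  ring

/-- The positive commutator estimate for the Laplacian. -/
theorem integral_lapR_mul_Xop_le (H : Cone Ω β h) (hη : 0 < η) {f : Eu 3 → ℝ}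
    (hf : CS (Mset Ω) f) : ∫ x in Mset Ω, lapR h f x * Xop η f x * sdet h x
      ≤ - ∫ x in Mset Ω, morDens β η f x := by
  have hX := hf.Xop (η := η) H.isOpen
  rw [H.green hf hX, neg_le_neg_iff]
  exact integral_le_of_le_add_pd H.isOpen_M (H.integrableOn_CS (H.CS_morDens hf))
    (H.integrableOn_CS (H.CS_gradR hX hf)) (H.CS_morFlux hf) 0 fun x hx => H.morDens_le hη hf hx

theorem integral_Rscal_mul_Xop_nonneg (H : Cone Ω β h) (hR : ∀ y ∈ Ω, 2 ≤ Rscal β y) (hη : 0 < η)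
    {f : Eu 3 → ℝ} (hf : CS (Mset Ω) f) :
    0 ≤ ∫ x in Mset Ω, Rscal h x * f x * Xop η f x * sdet h x := by
  have hk : SmoothOn Ω fun y => sdet β y * (Rscal β y - 2) / 2 :=
    (H.smoothOn_sdet.mul (H.smoothOn_Rscal.sub contDiffOn_const)).div_const _
  have hG := CS_block hk (contDiffOn_mul1 (η := η)) (hf.mul_right hf.1)
  have hQ : CS (Mset Ω) fun x => Rscal h x * f x * Xop η f x * sdet h x := by
    have hX := hf.Xop (η := η) H.isOpen
    have : SmoothOn (Mset Ω) (Rscal h) := by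
      refine ContDiffOn.congr (((smoothOn_radial (m := fun r => (r ^ 2)⁻¹)
        ((contDiffOn_id.pow 2).inv fun r hr => ?_)).mul ((smoothOn_comp_pr32
        H.smoothOn_Rscal).sub contDiffOn_const))) fun x hx => H.Rscal_eq hx
      rw [mem_Ioi] at hr; simp only [id]; positivity
    exact ((hf.mul_left this).mul_right hX.1).mul_right H.smoothOn_sdet_M
  have := integral_le_of_le_add_pd (P := fun _ => 0) H.isOpen_M (integrableOn_zero)
    (H.integrableOn_CS hQ) (hG.mul_left (g := fun _ => -1) contDiffOn_const) 0 fun x hx => ?_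
  · simpa using this
  have hr : 0 < x 0 := hx.1
  have hψ := (mul1_bounds hη hr).1
  have hψ' : 0 < mul1 η (x 0) := lt_of_lt_of_le (by positivity) hψ
  rw [pd_mul (differentiableAt_const _) (hG.1.diffAt H.isOpen_M hx), pd_const,
    H.pd_block hx hk (hasDerivAt_mul1 hη hr) (hf.1.mul hf.1), H.pd_sq hf.1 hx, H.Rscal_eq hx,
    H.sdet_eq hx]
  simp only [Xop, mul0, smul_eq_mul]
  have hb := H.sdet_pos hx.2
  have hR' : 0 ≤ Rscal β (pr32 x) - 2 := sub_nonneg.2 (hR _ hx.2)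
  have : 0 ≤ sdet β (pr32 x) * (Rscal β (pr32 x) - 2) * (mul1 η (x 0) / x 0) * (f x * f x) := by
    have := mul_self_nonneg (f x)
    positivity
  refine this.trans_eq ?_
  field_simp
  ring

theorem integral_lapR_mul_self (H : Cone Ω β h) {f : Eu 3 → ℝ} (hf : CS (Mset Ω) f) :
    ∫ x in Mset Ω, lapR h f x * f x * sdet h x = - ∫ x in Mset Ω, gradR h f f x * sdet h x :=
  H.green hf hf

theorem integral_Xop_sq_le (H : Cone Ω β h) (hη : 0 < η) {f : Eu 3 → ℝ} (hf : CS (Mset Ω) f) :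
    ∫ x in Mset Ω, Xop η f x * Xop η f x * sdet h x
      ≤ 10 * (1 / η + 1 / 2) ^ 2 * ∫ x in Mset Ω, gradR h f f x * sdet h x := by
  have hX := hf.Xop (η := η) H.isOpen
  rw [← integral_const_mul]
  have hG := CS_block H.smoothOn_sdet (contDiffOn_id (n := (⊤ : ℕ∞)) (𝕜 := ℝ) (s := Ioi 0))
    (hf.mul_right hf.1)
  refine integral_le_of_le_add_pd H.isOpen_M
    (H.integrableOn_CS ((hX.mul_right hX.1).mul_right H.smoothOn_sdet_M))
    ((H.integrableOn_CS (H.CS_gradR hf hf)).const_mul _)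
    (hG.mul_left (g := fun _ => 4 * (1 / η + 1 / 2) ^ 2) contDiffOn_const) 0 fun x hx => ?_
  have hr : 0 < x 0 := hx.1
  rw [pd_mul (differentiableAt_const _) (hG.1.diffAt H.isOpen_M hx), pd_const,
    H.pd_block hx H.smoothOn_sdet (hasDerivAt_id _) (hf.1.mul hf.1), H.pd_sq hf.1 hx,
    H.gradR_eq _ _ hx, H.sdet_eq hx]
  have hq := H.tanSq_nonneg f hx
  have hb := H.sdet_pos hx.2
  have hψ := mul1_bounds hη hr
  have hψ' : 0 < mul1 η (x 0) := lt_of_lt_of_le (by positivity) hψ.1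
  have hw := mul_wt_le_one hη hr
  have hw' : 0 < x 0 * wt η (x 0) := mul_pos hr (wt_pos hr)
  have e : x 0 * Xop η f x = mul1 η (x 0) * (x 0 * pd 0 f x)
      + (x 0 * wt η (x 0) / 2 + mul1 η (x 0)) * f x := by
    simp only [Xop, mul0, smul_eq_mul]; field_simp
  have e2 : (x 0 * Xop η f x) ^ 2
      ≤ 2 * (1 / η + 1 / 2) ^ 2 * ((x 0 * pd 0 f x) ^ 2 + f x ^ 2) := by
    rw [e]
    set c := 1 / η + 1 / 2 with hc
    have a1 : mul1 η (x 0) ^ 2 ≤ c ^ 2 := by gcongr; rw [hc]; linarith [hψ.2]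
    have a2 : (x 0 * wt η (x 0) / 2 + mul1 η (x 0)) ^ 2 ≤ c ^ 2 := by gcongr; rw [hc]; linarith [hψ.2]
    have a3 := mul_le_mul_of_nonneg_right a1 (sq_nonneg (x 0 * pd 0 f x))
    have a4 := mul_le_mul_of_nonneg_right a2 (sq_nonneg (f x))
    have a5 := sq_nonneg (mul1 η (x 0) * (x 0 * pd 0 f x)
      - (x 0 * wt η (x 0) / 2 + mul1 η (x 0)) * f x)
    nlinarith
  have e3 : 0 ≤ 2 * (1 / η + 1 / 2) ^ 2 * (2 * (x 0 * pd 0 f x) + f x) ^ 2 := by positivity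
  have e4 : 0 ≤ 10 * (1 / η + 1 / 2) ^ 2 * tanSq β f x := by positivity
  have := mul_le_mul_of_nonneg_left (add_le_add (add_le_add e2 e3) e4) hb.le
  change _ ≤ 10 * (1 / η + 1 / 2) ^ 2 * (sdet β (pr32 x) * (x 0 ^ 2 * (pd 0 f x * pd 0 f x)
    + tanSq β f x)) + _
  simp only [id]
  linarith

/-- The constant in the pointwise comparison `weights_le`. -/
def _root_.morConst (η : ℝ) : ℝ :=
  2 ^ (1 / 2 + η) * (4 * (1 + η)) + 2 ^ (3 / 2 + η) * (4 / (1 + η)) + 2 ^ (1 / 2 + η) * (2 * η)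

theorem _root_.morConst_pos {η : ℝ} (hη : 0 < η) : 0 < morConst η := by
  unfold morConst; positivity

theorem weights_le (H : Cone Ω β h) {η₁ η₂ : ℝ} (hη : 0 < η) (h1 : η ≤ η₁) (h2 : η ≤ η₂)
    (f : Eu 3 → ℝ) {x : Eu 3} (hx : x ∈ Mset Ω) :
    ((1 + (x 0) ^ 2) ^ (-(3 / 2 + η₁)) * (f x * f x)
        + (1 + (x 0) ^ 2) ^ (-(1 / 2 + η₂)) * gradR h f f x) * sdet h x
      ≤ morConst η * morDens β η f x := by
  have hr : 0 < x 0 := hx.1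
  have hq := H.tanSq_nonneg f hx
  have hb := H.sdet_pos hx.2
  have hψ := (mul1_bounds hη hr).1
  have hw := wt_pos (η := η) hr
  have hw1 := mul_wt_le_one hη hr
  have b1 := weight_zero_le hη h1 hr
  have b2 := weight_grad_le hη h2 hr
  have hg : gradR h f f x * sdet h x
      = sdet β (pr32 x) * ((x 0) ^ 2 * (pd 0 f x * pd 0 f x) + tanSq β f x) := H.gradR_eq _ _ hx
  rw [add_mul, mul_assoc _ (gradR h f f x), hg, H.sdet_eq hx]
  unfold morDens morConst
  have hf2 := mul_self_nonneg (f x)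
  have hp2 := mul_self_nonneg (pd 0 f x)
  set c1 : ℝ := 2 ^ (1 / 2 + η)
  set c2 : ℝ := 2 ^ (3 / 2 + η)
  have hc1 : 0 < c1 := by positivity
  have hc2 : 0 < c2 := by positivity
  generalize tanSq β f x = q at *
  generalize f x * f x = F at *
  generalize pd 0 f x * pd 0 f x = G at *
  generalize sdet β (pr32 x) = b at *
  generalize wt η (x 0) = w at *
  generalize mul1 η (x 0) = ψ at *
  generalize (1 + (x 0) ^ 2) ^ (-(3 / 2 + η₁)) = v1 at *
  generalize (1 + (x 0) ^ 2) ^ (-(1 / 2 + η₂)) = v2 at *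
  generalize x 0 = r at *
  have hψ0 : 0 < ψ := lt_of_lt_of_le (by positivity) hψ
  have hψr : w ≤ 2 * η * (ψ / r) := by
    have : 1 ≤ 2 * η * ψ := by rw [div_le_iff₀ (by positivity)] at hψ; linarith
    rw [mul_div_assoc', le_div_iff₀ hr]; linarith
  set C := c1 * (4 * (1 + η)) + c2 * (4 / (1 + η)) + c1 * (2 * η)
  have k1 : c1 ≤ C * (1 / (4 * (1 + η))) := by
    have : c1 = c1 * (4 * (1 + η)) * (1 / (4 * (1 + η))) := by field_simp
    nth_rw 1 [this]
    gcongr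
    have : 0 < c2 * (4 / (1 + η)) := by positivity
    have : 0 < c1 * (2 * η) := by positivity
    linarith
  have k2 : c2 ≤ C * ((1 + η) / 4) := by
    have : c2 = c2 * (4 / (1 + η)) * ((1 + η) / 4) := by field_simp
    nth_rw 1 [this]
    gcongr
    have : 0 < c1 * (4 * (1 + η)) := by positivity
    have : 0 < c1 * (2 * η) := by positivity
    linarith
  have k3 : c1 * (2 * η) ≤ C := by
    have : 0 < c1 * (4 * (1 + η)) := by positivity
    have : 0 < c2 * (4 / (1 + η)) := by positivity
    linarith
  have t1 : v2 * (b * (r ^ 2 * G)) ≤ C * (1 / (4 * (1 + η))) * w * (b * (r ^ 2 * G)) := by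
    gcongr; exact b2.trans (by gcongr)
  have t2 : v1 * (b * (r ^ 2 * F)) ≤ C * ((1 + η) / 4) * (w / (1 + r) ^ 2) * (b * (r ^ 2 * F)) := by
    gcongr; exact b1.trans (by gcongr)
  have t3 : v2 * (b * q) ≤ C * (ψ / r) * (b * q) := by
    gcongr
    calc v2 ≤ c1 * w := b2
      _ ≤ c1 * (2 * η * (ψ / r)) := by gcongr
      _ = c1 * (2 * η) * (ψ / r) := by ring
      _ ≤ _ := by gcongr
  calc _ = v2 * (b * (r ^ 2 * G)) + v1 * (b * (r ^ 2 * F)) + v2 * (b * q) := by ring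
    _ ≤ _ := add_le_add (add_le_add t1 t2) t3
    _ = _ := by ring

end Cone
end multiplier

/-- The real and imaginary parts of the components of a vector in `ℂ⁴`. -/
def rc (p : Fin 4 × Bool) : (Fin 4 → ℂ) →L[ℝ] ℝ :=
  (cond p.2 Complex.reCLM Complex.imCLM).comp (ContinuousLinearMap.proj p.1)

/-- The real inner product on `ℂ⁴`. -/
def rip (a b : Fin 4 → ℂ) : ℝ := ∑ p, rc p a * rc p b

/-- The antisymmetric operator `-iH`. -/
def Lop (A : Fin 3 → Eu 3 → Fin 4 → Fin 4 → ℂ) (B : Eu 3 → Fin 4 → Fin 4 → ℂ)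
    (f : Eu 3 → Fin 4 → ℂ) (x : Eu 3) : Fin 4 → ℂ := -Complex.I • Hop A B f x

/-- The principal symbol of `Lop`. -/
def symb (A : Fin 3 → Eu 3 → Fin 4 → Fin 4 → ℂ) (x : Eu 3) (ξ : Fin 3 → ℝ) (v : Fin 4 → ℂ) :
    Fin 4 → ℂ := fun i => -Complex.I * ∑ j, (ξ j : ℂ) * ∑ k, A j x i k * v k

section rip

theorem rip_eq_re (a b : Fin 4 → ℂ) : rip a b = (∑ c, (starRingEnd ℂ) (a c) * b c).re := by
  simp [rip, rc, Fintype.sum_prod_type, Complex.mul_re]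

theorem rip_comm (a b : Fin 4 → ℂ) : rip a b = rip b a :=
  Finset.sum_congr rfl fun _ _ => mul_comm _ _

theorem rip_add_left (a b c : Fin 4 → ℂ) : rip (a + b) c = rip a c + rip b c := by
  simp [rip, add_mul, Finset.sum_add_distrib]

theorem rip_smul_left (r : ℝ) (a b : Fin 4 → ℂ) : rip (r • a) b = r * rip a b := by
  simp [rip, mul_assoc, Finset.mul_sum]

theorem rip_smul_right (r : ℝ) (a b : Fin 4 → ℂ) : rip a (r • b) = r * rip a b := by
  rw [rip_comm, rip_smul_left, rip_comm]

theorem rip_zero_left (a : Fin 4 → ℂ) : rip 0 a = 0 := by simp [rip]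

theorem rip_self_nonneg (a : Fin 4 → ℂ) : 0 ≤ rip a a :=
  Finset.sum_nonneg fun _ _ => mul_self_nonneg _

theorem two_mul_abs_rip_le (a b : Fin 4 → ℂ) : 2 * |rip a b| ≤ rip a a + rip b b := by
  have h1 : rip a a + rip b b - 2 * rip a b = ∑ p, (rc p a - rc p b) ^ 2 := by
    simp only [rip, Finset.mul_sum, ← Finset.sum_add_distrib, ← Finset.sum_sub_distrib]
    exact Finset.sum_congr rfl fun _ _ => by ring
  have h2 : rip a a + rip b b + 2 * rip a b = ∑ p, (rc p a + rc p b) ^ 2 := by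
    simp only [rip, Finset.mul_sum, ← Finset.sum_add_distrib]
    exact Finset.sum_congr rfl fun _ _ => by ring
  have h3 : 0 ≤ ∑ p, (rc p a - rc p b) ^ 2 := Finset.sum_nonneg fun _ _ => sq_nonneg _
  have h4 : 0 ≤ ∑ p, (rc p a + rc p b) ^ 2 := Finset.sum_nonneg fun _ _ => sq_nonneg _
  rcases abs_cases (rip a b) with h | h <;> linarith

theorem rip_self_eq (a : Fin 4 → ℂ) : rip a a = ∑ c, ‖a c‖ ^ 2 := by
  simp [rip, rc, Fintype.sum_prod_type, ← Complex.normSq_eq_norm_sq, Complex.normSq_apply]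

theorem eq_zero_of_rip_self {a : Fin 4 → ℂ} (h : rip a a = 0) : a = 0 := by
  rw [rip_self_eq, Finset.sum_eq_zero_iff_of_nonneg fun _ _ => sq_nonneg _] at h
  funext c
  simpa using h c (Finset.mem_univ c)

theorem norm_mul_norm_le_rip (a : Fin 4 → ℂ) (i k : Fin 4) : ‖a i‖ * ‖a k‖ ≤ rip a a := by
  have h := fun c => Finset.single_le_sum (f := fun c => ‖a c‖ ^ 2)
    (fun _ _ => sq_nonneg _) (Finset.mem_univ c)
  rw [rip_self_eq]
  nlinarith [h i, h k, sq_nonneg (‖a i‖ - ‖a k‖)]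

theorem abs_rip_symb_le (A : Fin 3 → Eu 3 → Fin 4 → Fin 4 → ℂ) (x : Eu 3) (ξ : Fin 3 → ℝ)
    (v : Fin 4 → ℂ) :
    |rip (symb A x ξ v) v| ≤ (∑ i, ∑ j, |ξ j| * ∑ k, ‖A j x i k‖) * rip v v := by
  rw [rip_eq_re]
  refine (Complex.abs_re_le_norm _).trans ((norm_sum_le _ _).trans ?_)
  rw [Finset.sum_mul]
  refine Finset.sum_le_sum fun i _ => ?_
  rw [norm_mul, RCLike.norm_conj, symb, norm_mul, norm_neg, Complex.norm_I, one_mul]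
  calc _ ≤ (∑ j, |ξ j| * ∑ k, ‖A j x i k‖ * ‖v k‖) * ‖v i‖ := by
        gcongr
        refine (norm_sum_le _ _).trans (Finset.sum_le_sum fun j _ => ?_)
        rw [norm_mul, Complex.norm_real, Real.norm_eq_abs]
        gcongr
        exact (norm_sum_le _ _).trans_eq (Finset.sum_congr rfl fun k _ => norm_mul _ _)
    _ = ∑ j, |ξ j| * ∑ k, ‖A j x i k‖ * (‖v k‖ * ‖v i‖) := by
        simp only [Finset.sum_mul, mul_assoc]
    _ ≤ ∑ j, |ξ j| * ∑ k, ‖A j x i k‖ * rip v v := by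
        gcongr with j _ k _
        exact norm_mul_norm_le_rip v k i
    _ = _ := by simp only [Finset.sum_mul, mul_assoc]

end rip

section operator
variable {Ω : Set (Eu 2)} {β : Eu 2 → Matrix (Fin 2) (Fin 2) ℝ}
  {h : Eu 3 → Matrix (Fin 3) (Fin 3) ℝ} {η m : ℝ}
  {A : Fin 3 → Eu 3 → Fin 4 → Fin 4 → ℂ} {B : Eu 3 → Fin 4 → Fin 4 → ℂ}

theorem Hop_congr {M : Set (Eu 3)} (hM : IsOpen M) {f g : Eu 3 → Fin 4 → ℂ}
    (hfg : ∀ x ∈ M, f x = g x) {x : Eu 3} (hx : x ∈ M) : Hop A B f x = Hop A B g x := by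
  unfold Hop
  simp only [pd_congr hM hfg hx, hfg x hx]

theorem Lop_congr {M : Set (Eu 3)} (hM : IsOpen M) {f g : Eu 3 → Fin 4 → ℂ}
    (hfg : ∀ x ∈ M, f x = g x) {x : Eu 3} (hx : x ∈ M) : Lop A B f x = Lop A B g x := by
  rw [Lop, Lop, Hop_congr hM hfg hx]

theorem Lop_zero_of_closed {K : Set (Eu 3)} (hK : IsClosed K) {f : Eu 3 → Fin 4 → ℂ}
    (hf : ∀ x ∉ K, f x = 0) {x : Eu 3} (hx : x ∉ K) : Lop A B f x = 0 := by
  rw [Lop_congr hK.isOpen_compl (g := fun _ => 0) (fun y hy => hf y hy) hx]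
  funext i
  simp [Lop, Hop, pd_const]

theorem Lop_smul {W : Eu 3 → ℝ} {f : Eu 3 → Fin 4 → ℂ} {x : Eu 3} (hW : DifferentiableAt ℝ W x)
    (hf : DifferentiableAt ℝ f x) :
    Lop A B (fun y => W y • f y) x = W x • Lop A B f x + symb A x (fun j => pd j W x) (f x) := by
  funext i
  simp only [Lop, Hop, symb, pd_smul hW hf, Pi.add_apply, Pi.smul_apply, smul_eq_mul,
    Complex.real_smul]
  simp only [Finset.mul_sum, mul_add, Finset.sum_add_distrib]
  rw [add_right_comm]
  congr 1
  · congr 1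
    · exact Finset.sum_congr rfl fun _ _ => Finset.sum_congr rfl fun _ _ => by ring
    · exact Finset.sum_congr rfl fun _ _ => by ring
  · exact Finset.sum_congr rfl fun _ _ => Finset.sum_congr rfl fun _ _ => by ring

theorem Lop_const_smul (r : ℝ) {f : Eu 3 → Fin 4 → ℂ} {x : Eu 3} (hf : DifferentiableAt ℝ f x) :
    Lop A B (fun y => r • f y) x = r • Lop A B f x := by
  rw [Lop_smul (differentiableAt_const r) hf]
  simp only [pd_const]
  have : symb A x (fun _ => 0) (f x) = 0 := by funext i; simp [symb]
  rw [this, add_zero]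

theorem rip_Lop_self (f : Eu 3 → Fin 4 → ℂ) (x : Eu 3) :
    rip (Lop A B f x) (Lop A B f x) = ∑ c, ‖Hop A B f x c‖ ^ 2 := by
  simp [rip_self_eq, Lop]

/-- The standing assumptions on the metric and the Dirac operator. -/
structure DiracOp (Ω : Set (Eu 2)) (β : Eu 2 → Matrix (Fin 2) (Fin 2) ℝ)
    (h : Eu 3 → Matrix (Fin 3) (Fin 3) ℝ) (m : ℝ)
    (A : Fin 3 → Eu 3 → Fin 4 → Fin 4 → ℂ) (B : Eu 3 → Fin 4 → Fin 4 → ℂ) : Prop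
    extends Cone Ω β h where
  curv : ∀ y ∈ Ω, 2 ≤ Rscal β y
  smoothA : ∀ j i k, SmoothOn (Mset Ω) (fun x => A j x i k)
  smoothB : ∀ i k, SmoothOn (Mset Ω) (fun x => B x i k)
  symmetric : ∀ f g : Eu 3 → Fin 4 → ℂ, ContDiff ℝ (⊤ : ℕ∞) f → ContDiff ℝ (⊤ : ℕ∞) g →
    HasCompactSupport f → HasCompactSupport g → tsupport f ⊆ Mset Ω → tsupport g ⊆ Mset Ω →
    innM Ω h (Hop A B f) g = innM Ω h f (Hop A B g)
  square : ∀ f : Eu 3 → Fin 4 → ℂ, ContDiff ℝ (⊤ : ℕ∞) f → ∀ x ∈ Mset Ω, ∀ i : Fin 4,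
    Hop A B (Hop A B f) x i = ((m : ℂ) ^ 2) * f x i - lapC h (fun y => f y i) x
      + ((Rscal h x / 4 : ℝ) : ℂ) * f x i

theorem SmoothOn.comp_clm {n : ℕ} {F G : Type*} [NormedAddCommGroup F] [NormedSpace ℝ F]
    [NormedAddCommGroup G] [NormedSpace ℝ G] {M : Set (Eu n)} (L : F →L[ℝ] G) {f : Eu n → F}
    (hf : SmoothOn M f) : SmoothOn M fun x => L (f x) := L.contDiff.comp_contDiffOn hf

theorem Cone.CS_rip (H : Cone Ω β h) {f g : Eu 3 → Fin 4 → ℂ} (hf : CS (Mset Ω) f)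
    (hg : SmoothOn (Mset Ω) g) : CS (Mset Ω) fun x => rip (f x) (g x) * sdet h x :=
  (CS.sum _ fun p _ => (hf.clm (rc p)).mul_right (hg.comp_clm (rc p))).mul_right H.smoothOn_sdet_M

theorem Cone.integral_rip_eq_re (H : Cone Ω β h) {f g : Eu 3 → Fin 4 → ℂ} (hf : CS (Mset Ω) f)
    (hg : CS (Mset Ω) g) :
    ∫ x in Mset Ω, rip (f x) (g x) * sdet h x = (innM Ω h f g).re := by
  have hF : CS (Mset Ω) fun x => (∑ i, (starRingEnd ℂ) (f x i) * g x i) * ((sdet h x : ℝ) : ℂ) := by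
    refine hf.of_smoothOn ?_ fun x hx => by simp [hx]
    refine ContDiffOn.mul (ContDiffOn.sum fun i _ => ContDiffOn.mul ?_ ?_)
      (H.smoothOn_sdet_M.comp_clm Complex.ofRealCLM)
    · exact (hf.1.comp_clm (ContinuousLinearMap.proj (R := ℝ) (φ := fun _ : Fin 4 => ℂ) i)).comp_clm
        Complex.conjCLE.toContinuousLinearMap
    · exact hg.1.comp_clm (ContinuousLinearMap.proj (R := ℝ) (φ := fun _ : Fin 4 => ℂ) i)
  have := Complex.reCLM.integral_comp_comm (hF.integrable H.isOpen_M).integrableOn (μ := volume.restrict (Mset Ω))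
  unfold innM
  rw [← Complex.reCLM_apply, ← this]
  refine integral_congr_ae (Filter.Eventually.of_forall fun x => ?_)
  simp only [rip_eq_re, Complex.reCLM_apply]
  rw [Complex.re_mul_ofReal]

theorem ofReal_mul_eq_clm (ℓ : ℂ →L[ℝ] ℝ) (a : ℝ) (z : ℂ) : ℓ ((a : ℂ) * z) = a * ℓ z := by
  rw [← Complex.real_smul, map_smul, smul_eq_mul]

theorem Cone.clm_lapC (H : Cone Ω β h) (ℓ : ℂ →L[ℝ] ℝ) {f : Eu 3 → ℂ} (hf : SmoothOn (Mset Ω) f)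
    {x : Eu 3} (hx : x ∈ Mset Ω) : ℓ (lapC h f x) = lapR h (fun y => ℓ (f y)) x := by
  have hM := H.isOpen_M
  have hs : ∀ j, SmoothOn (Mset Ω) fun y => ((sdet h y : ℝ) : ℂ) *
      ∑ k, (((h y)⁻¹ j k : ℝ) : ℂ) * pd k f y := fun j =>
    (H.smoothOn_sdet_M.comp_clm Complex.ofRealCLM).mul (ContDiffOn.sum fun k _ =>
      ((H.smoothOn_inv_M j k).comp_clm Complex.ofRealCLM).mul (hf.pderiv hM k))
  unfold lapC lapR
  rw [← Complex.ofReal_inv, ofReal_mul_eq_clm, map_sum]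
  congr 1
  refine Finset.sum_congr rfl fun j _ => ?_
  rw [← pd_clm ℓ ((hs j).diffAt hM hx)]
  refine pd_congr hM (fun y hy => ?_) hx j
  rw [ofReal_mul_eq_clm, map_sum]
  congr 1
  refine Finset.sum_congr rfl fun k _ => ?_
  rw [ofReal_mul_eq_clm, pd_clm ℓ (hf.diffAt hM hy)]

theorem rc_Xop {f : Eu 3 → Fin 4 → ℂ} {x : Eu 3} (hf : DifferentiableAt ℝ f x) (p : Fin 4 × Bool) :
    rc p (Xop η f x) = Xop η (fun y => rc p (f y)) x := by
  simp [Xop, pd_clm (rc p) hf]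

theorem gradhSq_eq {f : Eu 3 → Fin 4 → ℂ} {x : Eu 3} (hf : DifferentiableAt ℝ f x) :
    gradhSq h f x = ∑ p, gradR h (fun y => rc p (f y)) (fun y => rc p (f y)) x := by
  have e : ∀ i c, pd i (fun y => f y c) x = pd i f x c := fun i c =>
    pd_clm (ContinuousLinearMap.proj (R := ℝ) (φ := fun _ : Fin 4 => ℂ) c) hf i
  simp only [gradhSq, gradR, pd_clm (rc _) hf, e]
  rw [Finset.sum_comm]
  rw [Finset.sum_comm (s := (Finset.univ : Finset (Fin 4 × Bool)))]
  rw [Finset.sum_comm]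
  refine Finset.sum_congr rfl fun i _ => ?_
  rw [Finset.sum_comm (s := (Finset.univ : Finset (Fin 4 × Bool)))]
  refine Finset.sum_congr rfl fun j _ => ?_
  rw [← Finset.mul_sum, ← Complex.re_sum, ← rip_eq_re]
  rfl

namespace DiracOp

theorem smoothOn_Hop (D : DiracOp Ω β h m A B) {f : Eu 3 → Fin 4 → ℂ} (hf : SmoothOn (Mset Ω) f) :
    SmoothOn (Mset Ω) (Hop A B f) := by
  refine contDiffOn_pi.2 fun i => ?_
  have c := fun (g : Eu 3 → Fin 4 → ℂ) (hg : SmoothOn (Mset Ω) g) (k : Fin 4) =>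
    hg.comp_clm (ContinuousLinearMap.proj (R := ℝ) (φ := fun _ : Fin 4 => ℂ) k)
  exact (ContDiffOn.sum fun j _ => ContDiffOn.sum fun k _ =>
    (D.smoothA j i k).mul (c _ (hf.pderiv D.isOpen_M j) k)).add
    (ContDiffOn.sum fun k _ => (D.smoothB i k).mul (c _ hf k))

theorem CS_Lop (D : DiracOp Ω β h m A B) {f : Eu 3 → Fin 4 → ℂ} (hf : CS (Mset Ω) f) : CS (Mset Ω) (Lop A B f) := by
  obtain ⟨h0, K, h1, h2, h3⟩ := hf
  exact ⟨contDiffOn_const.fun_smul (D.smoothOn_Hop h0), K, h1, h2,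
    fun x hx => Lop_zero_of_closed h1.isClosed h3 hx⟩

end DiracOp
end operator

section estimates
variable {Ω : Set (Eu 2)} {β : Eu 2 → Matrix (Fin 2) (Fin 2) ℝ}
  {h : Eu 3 → Matrix (Fin 3) (Fin 3) ℝ} {η m : ℝ}
  {A : Fin 3 → Eu 3 → Fin 4 → Fin 4 → ℂ} {B : Eu 3 → Fin 4 → Fin 4 → ℂ}

namespace DiracOp

theorem antisymm (D : DiracOp Ω β h m A B) {f g : Eu 3 → Fin 4 → ℂ} (hf : CS (Mset Ω) f)
    (hg : CS (Mset Ω) g) : ∫ x in Mset Ω, rip (Lop A B f x) (g x) * sdet h x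
      = - ∫ x in Mset Ω, rip (f x) (Lop A B g x) * sdet h x := by
  rw [D.integral_rip_eq_re (D.CS_Lop hf) hg, D.integral_rip_eq_re hf (D.CS_Lop hg)]
  have hM := D.isOpen_M
  have hs := D.symmetric f g (hf.contDiff hM) (hg.contDiff hM) hf.hasCompactSupport
    hg.hasCompactSupport hf.tsupport_subset hg.tsupport_subset
  have h1 : innM Ω h (Lop A B f) g = Complex.I * innM Ω h (Hop A B f) g := by
    unfold innM
    rw [← integral_const_mul]
    congr 1; funext x
    simp only [Lop, Pi.smul_apply, smul_eq_mul, map_mul, map_neg, Complex.conj_I, neg_neg, mul_assoc,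
      ← Finset.mul_sum]
  have h2 : innM Ω h f (Lop A B g) = -(Complex.I * innM Ω h f (Hop A B g)) := by
    unfold innM
    rw [← neg_mul, ← integral_const_mul]
    congr 1; funext x
    simp only [Lop, Pi.smul_apply, smul_eq_mul, mul_left_comm _ (-Complex.I), ← Finset.mul_sum,
      mul_assoc]
  rw [h1, h2, hs]
  simp

theorem rc_Lop_Lop (D : DiracOp Ω β h m A B) {f : Eu 3 → Fin 4 → ℂ} (hf : CS (Mset Ω) f)
    {x : Eu 3} (hx : x ∈ Mset Ω) (p : Fin 4 × Bool) :
    rc p (Lop A B (Lop A B f) x) = lapR h (fun y => rc p (f y)) x - m ^ 2 * rc p (f x)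
      - Rscal h x / 4 * rc p (f x) := by
  have hM := D.isOpen_M
  have e1 : Lop A B (Lop A B f) x = - Hop A B (Hop A B f) x := by
    have hd := (D.smoothOn_Hop hf.1).diffAt hM hx
    have : ∀ j, pd j (Lop A B f) x = -Complex.I • pd j (Hop A B f) x := fun j =>
      pd_clm ((-Complex.I) • ContinuousLinearMap.id ℂ (Fin 4 → ℂ)|>.restrictScalars ℝ) hd j
    funext i
    simp only [Pi.neg_apply]
    unfold Lop
    simp only [Pi.smul_apply, smul_eq_mul]
    change -Complex.I * Hop A B (Lop A B f) x i = _
    rw [Hop, Hop]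
    simp only [this]
    simp only [Lop, Pi.smul_apply, smul_eq_mul, mul_left_comm _ (-Complex.I), ← Finset.mul_sum,
      ← mul_add]
    rw [← mul_assoc]; simp
  have e2 : Lop A B (Lop A B f) x = fun i => lapC h (fun y => f y i) x - ((m ^ 2 : ℝ) : ℂ) * f x i
      - ((Rscal h x / 4 : ℝ) : ℂ) * f x i := by
    rw [e1]; funext i
    rw [Pi.neg_apply, D.square f (hf.contDiff hM) x hx i]; push_cast; ring
  rw [e2]
  obtain ⟨c, b⟩ := p
  have hsm : SmoothOn (Mset Ω) fun y => f y c :=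
    hf.1.comp_clm (ContinuousLinearMap.proj (R := ℝ) (φ := fun _ : Fin 4 => ℂ) c)
  simp only [rc, ContinuousLinearMap.comp_apply, ContinuousLinearMap.proj_apply]
  rw [map_sub, map_sub, ofReal_mul_eq_clm, ofReal_mul_eq_clm, D.clm_lapC _ hsm hx]

theorem integral_rip_Xop (D : DiracOp Ω β h m A B) (hη : 0 < η) {f : Eu 3 → Fin 4 → ℂ}
    (hf : CS (Mset Ω) f) : ∫ x in Mset Ω, rip (f x) (Xop η f x) * sdet h x = 0 := by
  have hM := D.isOpen_M
  have e : ∀ x ∈ Mset Ω, rip (f x) (Xop η f x) * sdet h x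
      = ∑ p, rc p (f x) * Xop η (fun y => rc p (f y)) x * sdet h x := fun x hx => by
    simp only [rip, rc_Xop (hf.1.diffAt hM hx), Finset.sum_mul]
  rw [setIntegral_congr_fun hM.measurableSet e, integral_finsetSum]
  · exact Finset.sum_eq_zero fun p _ => D.integral_mul_Xop hη (hf.clm (rc p))
  · exact fun p _ => D.integrableOn_CS (((hf.clm (rc p)).mul_right
      ((hf.clm (rc p)).Xop D.isOpen).1).mul_right D.smoothOn_sdet_M)

theorem integrableOn_lapR_mul (D : DiracOp Ω β h m A B) {f g : Eu 3 → ℝ} (hf : CS (Mset Ω) f)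
    (hg : CS (Mset Ω) g) : IntegrableOn (fun x => lapR h f x * g x * sdet h x) (Mset Ω) := by
  have hM := D.isOpen_M
  have : CS (Mset Ω) fun x => (∑ j, pd j (fun y => sdet h y * ∑ k, (h y)⁻¹ j k * pd k f y) x) * g x :=
    (CS.sum _ fun j _ => (D.CS_flux hf j).pderiv hM j).mul_right hg.1
  refine (D.integrableOn_CS this).congr_fun (fun x hx => ?_) hM.measurableSet
  simp only [← D.lapR_eq hx]; ring

theorem smoothOn_Rscal_M (D : DiracOp Ω β h m A B) : SmoothOn (Mset Ω) (Rscal h) := by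
  refine ContDiffOn.congr (((smoothOn_radial (m := fun r => (r ^ 2)⁻¹)
    ((contDiffOn_id.pow 2).inv fun r hr => ?_)).mul ((smoothOn_comp_pr32
    D.smoothOn_Rscal).sub contDiffOn_const))) fun x hx => D.Rscal_eq hx
  rw [mem_Ioi] at hr; simp only [id]; positivity

theorem integral_Lop_Lop_eq (D : DiracOp Ω β h m A B) {f g : Eu 3 → Fin 4 → ℂ}
    (hf : CS (Mset Ω) f) (hg : CS (Mset Ω) g) :
    ∫ x in Mset Ω, rip (Lop A B (Lop A B f) x) (g x) * sdet h x
      = ∑ p, ((∫ x in Mset Ω, lapR h (fun y => rc p (f y)) x * rc p (g x) * sdet h x)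
        - m ^ 2 * (∫ x in Mset Ω, rc p (f x) * rc p (g x) * sdet h x)
        - 1 / 4 * ∫ x in Mset Ω, Rscal h x * rc p (f x) * rc p (g x) * sdet h x) := by
  have hM := D.isOpen_M
  have i1 := fun p => D.integrableOn_lapR_mul (hf.clm (rc p)) (hg.clm (rc p))
  have i2 := fun p => (D.integrableOn_CS (((hf.clm (rc p)).mul_right (hg.clm (rc p)).1).mul_right
    D.smoothOn_sdet_M)).const_mul (m ^ 2)
  have i3 := fun p => (D.integrableOn_CS ((((hf.clm (rc p)).mul_left D.smoothOn_Rscal_M).mul_right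
    (hg.clm (rc p)).1).mul_right D.smoothOn_sdet_M)).const_mul (1 / 4)
  have e : ∀ x ∈ Mset Ω, rip (Lop A B (Lop A B f) x) (g x) * sdet h x
      = ∑ p, (lapR h (fun y => rc p (f y)) x * rc p (g x) * sdet h x
        - m ^ 2 * (rc p (f x) * rc p (g x) * sdet h x)
        - 1 / 4 * (Rscal h x * rc p (f x) * rc p (g x) * sdet h x)) := fun x hx => by
    simp only [rip, D.rc_Lop_Lop hf hx, Finset.sum_mul]
    exact Finset.sum_congr rfl fun p _ => by ring
  have i4 : ∀ p, IntegrableOn (fun x => lapR h (fun y => rc p (f y)) x * rc p (g x) * sdet h x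
      - m ^ 2 * (rc p (f x) * rc p (g x) * sdet h x)) (Mset Ω) := fun p => (i1 p).sub (i2 p)
  have i5 : ∀ p, IntegrableOn (fun x => lapR h (fun y => rc p (f y)) x * rc p (g x) * sdet h x
      - m ^ 2 * (rc p (f x) * rc p (g x) * sdet h x)
      - 1 / 4 * (Rscal h x * rc p (f x) * rc p (g x) * sdet h x)) (Mset Ω) :=
    fun p => (i4 p).sub (i3 p)
  rw [setIntegral_congr_fun hM.measurableSet e, integral_finsetSum _ fun p _ => i5 p]
  refine Finset.sum_congr rfl fun p _ => ?_
  rw [integral_sub (i4 p) (i3 p), integral_sub (i1 p) (i2 p), integral_const_mul,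
    integral_const_mul]

/-- The positive commutator estimate for the squared Dirac operator. -/
theorem integral_Lop_Lop_Xop_le (D : DiracOp Ω β h m A B) (hη : 0 < η) {f : Eu 3 → Fin 4 → ℂ}
    (hf : CS (Mset Ω) f) :
    ∫ x in Mset Ω, rip (Lop A B (Lop A B f) x) (Xop η f x) * sdet h x
      ≤ - ∫ x in Mset Ω, ∑ p, morDens β η (fun y => rc p (f y)) x := by
  have hM := D.isOpen_M
  rw [D.integral_Lop_Lop_eq hf (hf.Xop D.isOpen),
    integral_finsetSum _ fun p _ => D.integrableOn_CS (D.CS_morDens (hf.clm (rc p))),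
    ← Finset.sum_neg_distrib]
  refine Finset.sum_le_sum fun p _ => ?_
  have c := fun (F : Eu 3 → ℝ) => setIntegral_congr_fun (μ := volume) hM.measurableSet
    (f := fun x => F x * rc p (Xop η f x) * sdet h x)
    (g := fun x => F x * Xop η (fun y => rc p (f y)) x * sdet h x)
    fun x hx => by simp only [rc_Xop (hf.1.diffAt hM hx)]
  have hp := hf.clm (rc p)
  rw [c, c fun x => rc p (f x), c fun x => Rscal h x * rc p (f x), D.integral_mul_Xop hη hp]
  have h1 := D.integral_lapR_mul_Xop_le hη hp
  have h2 := D.integral_Rscal_mul_Xop_nonneg D.curv hη hp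
  linarith

theorem sum_integral_gradR_le (D : DiracOp Ω β h m A B) {f : Eu 3 → Fin 4 → ℂ}
    (hf : CS (Mset Ω) f) :
    ∑ p, ∫ x in Mset Ω, gradR h (fun y => rc p (f y)) (fun y => rc p (f y)) x * sdet h x
      ≤ ∫ x in Mset Ω, rip (Lop A B f x) (Lop A B f x) * sdet h x := by
  have hM := D.isOpen_M
  have e := D.antisymm (D.CS_Lop hf) hf
  rw [D.integral_Lop_Lop_eq hf hf] at e
  rw [← neg_eq_iff_eq_neg.2 e, ← Finset.sum_neg_distrib]
  refine Finset.sum_le_sum fun p _ => ?_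
  rw [D.integral_lapR_mul_self (hf.clm (rc p))]
  have h1 : 0 ≤ ∫ x in Mset Ω, rc p (f x) * rc p (f x) * sdet h x :=
    setIntegral_nonneg hM.measurableSet fun x hx =>
      mul_nonneg (mul_self_nonneg _) (D.sdet_M_pos hx).le
  have h2 : 0 ≤ ∫ x in Mset Ω, Rscal h x * rc p (f x) * rc p (f x) * sdet h x :=
    setIntegral_nonneg hM.measurableSet fun x hx => by
      rw [mul_assoc (Rscal h x)]
      refine mul_nonneg (mul_nonneg ?_ (mul_self_nonneg _)) (D.sdet_M_pos hx).le
      rw [D.Rscal_eq hx]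
      exact mul_nonneg (by positivity) (sub_nonneg.2 (D.curv _ hx.2))
  have h3 := mul_nonneg (sq_nonneg m) h1
  linarith

theorem abs_integral_Lop_Xop_le (D : DiracOp Ω β h m A B) (hη : 0 < η) {f : Eu 3 → Fin 4 → ℂ}
    (hf : CS (Mset Ω) f) : |∫ x in Mset Ω, rip (Lop A B f x) (Xop η f x) * sdet h x|
      ≤ (1 / 2 + 5 * (1 / η + 1 / 2) ^ 2)
        * ∫ x in Mset Ω, rip (Lop A B f x) (Lop A B f x) * sdet h x := by
  have hM := D.isOpen_M
  have hL := D.CS_Lop hf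
  have hX := hf.Xop (η := η) D.isOpen
  have i1 := D.integrableOn_CS (D.CS_rip hL hL.1)
  have i2 := D.integrableOn_CS (D.CS_rip hX hX.1)
  have h1 : |∫ x in Mset Ω, rip (Lop A B f x) (Xop η f x) * sdet h x|
      ≤ ∫ x in Mset Ω, 1 / 2 * (rip (Lop A B f x) (Lop A B f x) * sdet h x
        + rip (Xop η f x) (Xop η f x) * sdet h x) := by
    refine (abs_integral_le_integral_abs).trans (setIntegral_mono_on
      (D.integrableOn_CS (D.CS_rip hL hX.1)).abs ((i1.add i2).const_mul _) hM.measurableSet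
      fun x hx => ?_)
    rw [abs_mul, abs_of_pos (D.sdet_M_pos hx), ← add_mul, ← mul_assoc]
    exact mul_le_mul_of_nonneg_right (by linarith [two_mul_abs_rip_le (Lop A B f x) (Xop η f x)])
      (D.sdet_M_pos hx).le
  have h2 : ∫ x in Mset Ω, rip (Xop η f x) (Xop η f x) * sdet h x
      ≤ 10 * (1 / η + 1 / 2) ^ 2
        * ∫ x in Mset Ω, rip (Lop A B f x) (Lop A B f x) * sdet h x := by
    have e : ∀ x ∈ Mset Ω, rip (Xop η f x) (Xop η f x) * sdet h x
        = ∑ p, Xop η (fun y => rc p (f y)) x * Xop η (fun y => rc p (f y)) x * sdet h x :=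
      fun x hx => by simp only [rip, rc_Xop (hf.1.diffAt hM hx), Finset.sum_mul]
    rw [setIntegral_congr_fun hM.measurableSet e, integral_finsetSum]
    · refine (Finset.sum_le_sum fun p _ => D.integral_Xop_sq_le hη (hf.clm (rc p))).trans ?_
      rw [← Finset.mul_sum]
      gcongr
      exact D.sum_integral_gradR_le hf
    · intro p _
      have hp := (hf.clm (rc p)).Xop (η := η) D.isOpen
      exact D.integrableOn_CS ((hp.mul_right hp.1).mul_right D.smoothOn_sdet_M)
  rw [integral_const_mul, integral_add i1 i2] at h1
  linarith

theorem integral_weights_le (D : DiracOp Ω β h m A B) {η₁ η₂ : ℝ} (hη : 0 < η) (h1 : η ≤ η₁)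
    (h2 : η ≤ η₂) {f : Eu 3 → Fin 4 → ℂ} (hf : CS (Mset Ω) f) :
    ∫ x in Mset Ω, ((1 + (x 0) ^ 2) ^ (-(3 / 2 + η₁)) * (∑ c, ‖f x c‖ ^ 2)
        + (1 + (x 0) ^ 2) ^ (-(1 / 2 + η₂)) * gradhSq h f x) * sdet h x
      ≤ morConst η * ∫ x in Mset Ω, ∑ p, morDens β η (fun y => rc p (f y)) x := by
  have hM := D.isOpen_M
  rw [← integral_const_mul]
  refine integral_mono_of_nonneg ?_ ((integrable_finsetSum _ fun p _ =>
    D.integrableOn_CS (D.CS_morDens (hf.clm (rc p)))).const_mul _) ?_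
  all_goals
    refine (ae_restrict_iff' hM.measurableSet).2 (Filter.Eventually.of_forall fun x hx => ?_)
    simp only [Pi.zero_apply]
    rw [gradhSq_eq (hf.1.diffAt hM hx)]
  · have hg : ∀ p, 0 ≤ gradR h (fun y => rc p (f y)) (fun y => rc p (f y)) x := fun p => by
      have e := D.gradR_eq (fun y => rc p (f y)) (fun y => rc p (f y)) hx
      have hq : 0 ≤ tanSq β (fun y => rc p (f y)) x := D.tanSq_nonneg _ hx
      have hb := D.sdet_pos hx.2
      refine nonneg_of_mul_nonneg_left (b := sdet h x) ?_ (D.sdet_M_pos hx)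
      rw [e]
      exact mul_nonneg hb.le (add_nonneg (mul_nonneg (sq_nonneg _) (mul_self_nonneg _)) hq)
    have := D.sdet_M_pos hx
    have := Finset.sum_nonneg fun p (_ : p ∈ Finset.univ) => hg p
    positivity
  · rw [← rip_self_eq, rip, Finset.mul_sum, Finset.mul_sum, ← Finset.sum_add_distrib,
      Finset.sum_mul, Finset.mul_sum]
    exact Finset.sum_le_sum fun p _ => D.weights_le hη h1 h2 (fun y => rc p (f y)) hx

end DiracOp
end estimates

/-- Smoothness in space-time over `ℝ × M`. -/
abbrev JS {F : Type*} [NormedAddCommGroup F] [NormedSpace ℝ F] {n : ℕ} (M : Set (Eu n))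
    (v : ℝ → Eu n → F) : Prop :=
  ContDiffOn ℝ (⊤ : ℕ∞) (fun p : ℝ × Eu n => v p.1 p.2) ((univ : Set ℝ) ×ˢ M)

section joint
variable {n : ℕ} {M : Set (Eu n)} {F : Type*} [NormedAddCommGroup F] [NormedSpace ℝ F]
  {G : Type*} [NormedAddCommGroup G] [NormedSpace ℝ G]

theorem JS.slice {v : ℝ → Eu n → F} (hv : JS M v) (t : ℝ) : SmoothOn M (v t) :=
  hv.comp (f := fun x => (t, x)) (contDiff_const.prodMk contDiff_id).contDiffOn fun _ hx => ⟨trivial, hx⟩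

theorem JS.of_smoothOn {f : Eu n → F} (hf : SmoothOn M f) : JS M fun _ => f :=
  ContDiffOn.comp hf contDiff_snd.contDiffOn fun _ hx => hx.2

theorem JS.clm (L : F →L[ℝ] G) {v : ℝ → Eu n → F} (hv : JS M v) : JS M fun t x => L (v t x) :=
  L.contDiff.comp_contDiffOn hv

theorem JS.contDiffAt {v : ℝ → Eu n → F} (hv : JS M v) (hM : IsOpen M) (t : ℝ) {x : Eu n}
    (hx : x ∈ M) : ContDiffAt ℝ (⊤ : ℕ∞) (fun p : ℝ × Eu n => v p.1 p.2) (t, x) :=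
  ContDiffOn.contDiffAt hv ((isOpen_univ.prod hM).mem_nhds ⟨trivial, hx⟩)

theorem JS.pd_eq {v : ℝ → Eu n → F} (hv : JS M v) (hM : IsOpen M) (t : ℝ) {x : Eu n}
    (hx : x ∈ M) (j : Fin n) : pd j (v t) x
      = fderiv ℝ (fun p : ℝ × Eu n => v p.1 p.2) (t, x) (0, EuclideanSpace.single j 1) := by
  have h1 := ((hv.contDiffAt hM t hx).differentiableAt (by simp)).hasFDerivAt
  have h2 : HasFDerivAt (fun y : Eu n => (t, y)) (ContinuousLinearMap.inr ℝ ℝ (Eu n)) x :=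
    hasFDerivAt_prodMk_right t x
  have := (h1.comp x h2).fderiv
  unfold pd
  rw [show v t = (fun p : ℝ × Eu n => v p.1 p.2) ∘ fun y => (t, y) from rfl, this]
  rfl

theorem JS.hasDerivAt {v : ℝ → Eu n → F} (hv : JS M v) (hM : IsOpen M) (t : ℝ) {x : Eu n}
    (hx : x ∈ M) : HasDerivAt (fun s => v s x)
      (fderiv ℝ (fun p : ℝ × Eu n => v p.1 p.2) (t, x) (1, 0)) t := by
  have h1 := ((hv.contDiffAt hM t hx).differentiableAt (by simp)).hasFDerivAt
  have h2 : HasFDerivAt (fun s : ℝ => (s, x)) (ContinuousLinearMap.inl ℝ ℝ (Eu n)) t :=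
    hasFDerivAt_prodMk_left t x
  exact (h1.comp t h2).hasDerivAt

theorem JS.fderiv_apply {v : ℝ → Eu n → F} (hv : JS M v) (hM : IsOpen M) (w : ℝ × Eu n) :
    JS M fun t x => fderiv ℝ (fun p : ℝ × Eu n => v p.1 p.2) (t, x) w := by
  have : ContDiffOn ℝ (⊤ : ℕ∞) (fderiv ℝ (fun p : ℝ × Eu n => v p.1 p.2)) (univ ×ˢ M) :=
    ContDiffOn.fderiv_of_isOpen hv (isOpen_univ.prod hM) (by simp)
  exact this.clm_apply contDiffOn_const

theorem JS.congr {v w : ℝ → Eu n → F} (hv : JS M v) (h : ∀ t, ∀ x ∈ M, w t x = v t x) : JS M w :=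
  ContDiffOn.congr hv fun p hp => h p.1 p.2 hp.2

theorem JS.pderiv {v : ℝ → Eu n → F} (hv : JS M v) (hM : IsOpen M) (j : Fin n) :
    JS M fun t => pd j (v t) :=
  (hv.fderiv_apply hM (0, EuclideanSpace.single j 1)).congr fun t _ hx => hv.pd_eq hM t hx j

theorem JS.fderiv_fderiv {v : ℝ → Eu n → F} (hv : JS M v) (hM : IsOpen M) (w w' : ℝ × Eu n)
    (t : ℝ) {x : Eu n} (hx : x ∈ M) :
    fderiv ℝ (fun p : ℝ × Eu n => fderiv ℝ (fun p : ℝ × Eu n => v p.1 p.2) (p.1, p.2) w) (t, x) w'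
      = fderiv ℝ (fun p : ℝ × Eu n => fderiv ℝ (fun p : ℝ × Eu n => v p.1 p.2) (p.1, p.2) w') (t, x) w := by
  have h1 := hv.contDiffAt hM t hx
  have h2 : IsSymmSndFDerivAt ℝ (fun p : ℝ × Eu n => v p.1 p.2) (t, x) := h1.isSymmSndFDerivAt (by
    rw [minSmoothness_of_isRCLikeNormedField]; exact WithTop.coe_le_coe.2 le_top)
  have hd : DifferentiableAt ℝ (fderiv ℝ (fun p : ℝ × Eu n => v p.1 p.2)) (t, x) :=
    (h1.fderiv_right (m := 1) (by norm_cast)).differentiableAt (by simp)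
  have e : ∀ a b : ℝ × Eu n, fderiv ℝ (fun p : ℝ × Eu n =>
      fderiv ℝ (fun p : ℝ × Eu n => v p.1 p.2) (p.1, p.2) a) (t, x) b
      = fderiv ℝ (fderiv ℝ (fun p : ℝ × Eu n => v p.1 p.2)) (t, x) b a := fun a b => by
    simp only [Prod.mk.eta]
    rw [fderiv_clm_apply hd (differentiableAt_const a)]
    simp
  rw [e, e]
  exact h2.eq w' w

theorem JS.hasDerivAt_pd {v v' : ℝ → Eu n → F} (hv : JS M v) (hM : IsOpen M)
    (hd : ∀ t, ∀ x ∈ M, HasDerivAt (fun s => v s x) (v' t x) t) (t : ℝ) {x : Eu n}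
    (hx : x ∈ M) (j : Fin n) : HasDerivAt (fun s => pd j (v s) x) (pd j (v' t) x) t := by
  have h1 := (hv.fderiv_apply hM (0, EuclideanSpace.single j 1)).hasDerivAt hM t hx
  rw [hv.fderiv_fderiv hM _ _ t hx] at h1
  have h2 := (hv.fderiv_apply hM (1, 0)).pd_eq hM t hx j
  rw [← h2] at h1
  have h3 : pd j (v' t) x = pd j
      (fun x => fderiv ℝ (fun p : ℝ × Eu n => v p.1 p.2) (t, x) (1, 0)) x :=
    pd_congr hM (fun y hy => (hd t y hy).unique (hv.hasDerivAt hM t hy)) hx j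
  rw [h3]
  refine h1.congr_of_eventuallyEq (Filter.Eventually.of_forall fun s => hv.pd_eq hM s hx j)

/-- Differentiation under the integral for integrands with locally uniform compact support. -/
theorem hasDerivAt_integral_of_compact {f f' : ℝ → Eu n → ℝ} {t₀ δ : ℝ} {K : Set (Eu n)}
    (hM : IsOpen M) (hK : IsCompact K) (hKM : K ⊆ M) (hδ : 0 < δ)
    (hf : ContinuousOn (fun p : ℝ × Eu n => f p.1 p.2) (univ ×ˢ M))
    (hf' : ContinuousOn (fun p : ℝ × Eu n => f' p.1 p.2) (univ ×ˢ M))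
    (h0 : ∀ s, |s - t₀| < δ → ∀ x ∉ K, f s x = 0)
    (hd : ∀ s, ∀ x ∈ M, HasDerivAt (fun s => f s x) (f' s x) s) :
    HasDerivAt (fun s => ∫ x in M, f s x) (∫ x in M, f' t₀ x) t₀ := by
  have hsl : ∀ s, ContinuousOn (f s) M := fun s =>
    hf.comp (f := fun x => (s, x)) (by fun_prop) fun _ hx => ⟨trivial, hx⟩
  have hsl' : ∀ s, ContinuousOn (f' s) M := fun s =>
    hf'.comp (f := fun x => (s, x)) (by fun_prop) fun _ hx => ⟨trivial, hx⟩
  have h0' : ∀ s, |s - t₀| < δ → ∀ x ∈ M, x ∉ K → f' s x = 0 := fun s hs x hx hxK => by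
    refine (hd s x hx).unique ((hasDerivAt_const s (0 : ℝ)).congr_of_eventuallyEq ?_)
    have : Metric.ball t₀ δ ∈ nhds s := Metric.isOpen_ball.mem_nhds (by simpa [Real.dist_eq] using hs)
    filter_upwards [this] with r hr
    exact h0 r (by simpa [Real.dist_eq] using hr) x hxK
  obtain ⟨C, hC⟩ := (isCompact_Icc (a := t₀ - δ) (b := t₀ + δ) |>.prod hK).exists_bound_of_continuousOn
    (hf'.mono (prod_mono (subset_univ _) hKM))
  refine (hasDerivAt_integral_of_dominated_loc_of_deriv_le (s := Metric.ball t₀ δ) (F := f)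
    (bound := K.indicator fun _ => C)
    (Metric.ball_mem_nhds t₀ hδ) (Filter.Eventually.of_forall fun s =>
      (hsl s).aestronglyMeasurable hM.measurableSet) ?_
    ((hsl' t₀).aestronglyMeasurable hM.measurableSet) ?_ ?_ ?_).2
  · exact (((hsl t₀).mono hKM).integrableOn_compact hK
      |>.integrable_of_forall_notMem_eq_zero fun x hx => h0 t₀ (by simpa using hδ) x hx).integrableOn
  · refine (ae_restrict_iff' hM.measurableSet).2 (Filter.Eventually.of_forall fun x hx s hs => ?_)
    rw [Metric.mem_ball, Real.dist_eq] at hs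
    by_cases hxK : x ∈ K
    · rw [indicator_of_mem hxK]
      have := abs_lt.1 hs
      exact hC (s, x) ⟨⟨by linarith, by linarith⟩, hxK⟩
    · rw [h0' s hs x hx hxK, indicator_of_notMem hxK]; simp
  · exact (integrable_indicator_iff hK.measurableSet).2
      (integrableOn_const hK.measure_lt_top.ne) |>.integrableOn
  · exact (ae_restrict_iff' hM.measurableSet).2
      (Filter.Eventually.of_forall fun x hx s _ => hd s x hx)

end joint

section evolution
variable {Ω : Set (Eu 2)} {β : Eu 2 → Matrix (Fin 2) (Fin 2) ℝ}
  {h : Eu 3 → Matrix (Fin 3) (Fin 3) ℝ} {η m : ℝ}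
  {A : Fin 3 → Eu 3 → Fin 4 → Fin 4 → ℂ} {B : Eu 3 → Fin 4 → Fin 4 → ℂ}
  {κ : ℝ → ℝ} {u : ℝ → Eu 3 → Fin 4 → ℂ}

/-- Locally uniform compact support in time near `t₀`. -/
def LocSupp {n : ℕ} {F : Type*} [Zero F] (M : Set (Eu n)) (u : ℝ → Eu n → F) (t₀ : ℝ) : Prop :=
  ∃ δ > 0, ∃ K, IsCompact K ∧ K ⊆ M ∧ ∀ s, |s - t₀| < δ → ∀ x ∉ K, u s x = 0

/-- Solutions of `∂ₜ u = κ L u`. -/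
structure Sol (Ω : Set (Eu 2)) (A : Fin 3 → Eu 3 → Fin 4 → Fin 4 → ℂ)
    (B : Eu 3 → Fin 4 → Fin 4 → ℂ) (κ : ℝ → ℝ) (u : ℝ → Eu 3 → Fin 4 → ℂ) : Prop where
  smooth : JS (Mset Ω) u
  cs : ∀ t, CS (Mset Ω) (u t)
  eq : ∀ t, ∀ x ∈ Mset Ω, HasDerivAt (fun s => u s x) (κ t • Lop A B (u t) x) t

theorem LocSupp.lop {t₀ : ℝ} (hu : LocSupp (Mset Ω) u t₀) :
    LocSupp (Mset Ω) (fun t => Lop A B (u t)) t₀ := by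
  obtain ⟨δ, hδ, K, h1, h2, h3⟩ := hu
  exact ⟨δ, hδ, K, h1, h2, fun s hs x hx => Lop_zero_of_closed h1.isClosed (h3 s hs) hx⟩

theorem hasDerivAt_rip {v w : ℝ → Fin 4 → ℂ} {v' w' : Fin 4 → ℂ} {t : ℝ} (hv : HasDerivAt v v' t)
    (hw : HasDerivAt w w' t) :
    HasDerivAt (fun s => rip (v s) (w s)) (rip v' (w t) + rip (v t) w') t := by
  unfold rip
  rw [← Finset.sum_add_distrib]
  exact HasDerivAt.fun_sum fun p _ =>
    ((rc p).hasFDerivAt.comp_hasDerivAt t hv).mul ((rc p).hasFDerivAt.comp_hasDerivAt t hw)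

theorem continuousOn_rip {v w : ℝ → Eu 3 → Fin 4 → ℂ} {S : Set (ℝ × Eu 3)}
    (hv : ContinuousOn (fun p : ℝ × Eu 3 => v p.1 p.2) S)
    (hw : ContinuousOn (fun p : ℝ × Eu 3 => w p.1 p.2) S) :
    ContinuousOn (fun p : ℝ × Eu 3 => rip (v p.1 p.2) (w p.1 p.2)) S :=
  continuousOn_finsetSum _ fun p _ => ((rc p).continuous.comp_continuousOn hv).mul
    ((rc p).continuous.comp_continuousOn hw)

/-- The time derivative of a pairing. -/
theorem Cone.hasDerivAt_integral_rip (H : Cone Ω β h) {v v' w w' : ℝ → Eu 3 → Fin 4 → ℂ} {t₀ : ℝ}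
    (hs : LocSupp (Mset Ω) v t₀) (hv : JS (Mset Ω) v) (hw : JS (Mset Ω) w)
    (hv' : ∀ t, ∀ x ∈ Mset Ω, HasDerivAt (fun s => v s x) (v' t x) t)
    (hw' : ∀ t, ∀ x ∈ Mset Ω, HasDerivAt (fun s => w s x) (w' t x) t) :
    HasDerivAt (fun t => ∫ x in Mset Ω, rip (v t x) (w t x) * sdet h x)
      (∫ x in Mset Ω, (rip (v' t₀ x) (w t₀ x) + rip (v t₀ x) (w' t₀ x)) * sdet h x) t₀ := by
  obtain ⟨δ, hδ, K, h1, h2, h3⟩ := hs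
  have hM := H.isOpen_M
  have cω : ContinuousOn (fun p : ℝ × Eu 3 => sdet h p.2) (univ ×ˢ Mset Ω) :=
    (JS.of_smoothOn H.smoothOn_sdet_M).continuousOn
  have c' : ∀ {z z' : ℝ → Eu 3 → Fin 4 → ℂ}, JS (Mset Ω) z →
      (∀ t, ∀ x ∈ Mset Ω, HasDerivAt (fun s => z s x) (z' t x) t) →
      ContinuousOn (fun p : ℝ × Eu 3 => z' p.1 p.2) (univ ×ˢ Mset Ω) := fun hz hz' =>
    (hz.fderiv_apply hM (1, 0)).continuousOn.congr fun p hp =>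
      (hz' p.1 p.2 hp.2).unique (hz.hasDerivAt hM p.1 hp.2)
  refine hasDerivAt_integral_of_compact (f := fun t x => rip (v t x) (w t x) * sdet h x)
    (f' := fun t x => (rip (v' t x) (w t x) + rip (v t x) (w' t x)) * sdet h x) hM h1 h2 hδ
    ((continuousOn_rip hv.continuousOn hw.continuousOn).mul cω)
    (((continuousOn_rip (c' hv hv') hw.continuousOn).add
      (continuousOn_rip hv.continuousOn (c' hw hw'))).mul cω) ?_ ?_
  · intro s hs x hx
    rw [h3 s hs x hx, rip_zero_left, zero_mul]
  · intro s x hx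
    exact (hasDerivAt_rip (hv' s x hx) (hw' s x hx)).mul_const _

namespace DiracOp

theorem JS_Lop (D : DiracOp Ω β h m A B) (hu : JS (Mset Ω) u) :
    JS (Mset Ω) fun t => Lop A B (u t) := by
  have c := fun (g : ℝ → Eu 3 → Fin 4 → ℂ) (hg : JS (Mset Ω) g) (k : Fin 4) =>
    hg.clm (ContinuousLinearMap.proj (R := ℝ) (φ := fun _ : Fin 4 => ℂ) k)
  refine contDiffOn_pi.2 fun i => ?_
  exact contDiffOn_const.mul ((ContDiffOn.sum fun j _ => ContDiffOn.sum fun k _ =>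
    (JS.of_smoothOn (D.smoothA j i k)).mul (c _ (hu.pderiv D.isOpen_M j) k)).add
    (ContDiffOn.sum fun k _ => (JS.of_smoothOn (D.smoothB i k)).mul (c _ hu k)))

theorem hasDerivAt_Lop (D : DiracOp Ω β h m A B) (hu : JS (Mset Ω) u) {u' : ℝ → Eu 3 → Fin 4 → ℂ}
    (hd : ∀ t, ∀ x ∈ Mset Ω, HasDerivAt (fun s => u s x) (u' t x) t) (t : ℝ) {x : Eu 3}
    (hx : x ∈ Mset Ω) : HasDerivAt (fun s => Lop A B (u s) x) (Lop A B (u' t) x) t := by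
  refine hasDerivAt_pi.2 fun i => ?_
  exact (HasDerivAt.add (HasDerivAt.fun_sum fun j _ => HasDerivAt.fun_sum fun k _ =>
      (hasDerivAt_pi.1 (hu.hasDerivAt_pd D.isOpen_M hd t hx j) k).const_mul _)
    (HasDerivAt.fun_sum fun k _ => (hasDerivAt_pi.1 (hd t x hx) k).const_mul _)).const_mul _

theorem sol_Lop (D : DiracOp Ω β h m A B) (hu : Sol Ω A B κ u) :
    Sol Ω A B κ fun t => Lop A B (u t) where
  smooth := D.JS_Lop hu.smooth
  cs t := D.CS_Lop (hu.cs t)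
  eq t x hx := by
    have := D.hasDerivAt_Lop hu.smooth hu.eq t hx
    rwa [Lop_const_smul _ ((D.CS_Lop (hu.cs t)).1.diffAt D.isOpen_M hx)] at this

/-- Conservation of the `L²` norm. -/
theorem hasDerivAt_energy (D : DiracOp Ω β h m A B) (hu : Sol Ω A B κ u) {t₀ : ℝ}
    (hs : LocSupp (Mset Ω) u t₀) :
    HasDerivAt (fun t => ∫ x in Mset Ω, rip (u t x) (u t x) * sdet h x) 0 t₀ := by
  refine (D.hasDerivAt_integral_rip hs hu.smooth hu.smooth hu.eq hu.eq).congr_deriv ?_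
  have h1 := D.antisymm (hu.cs t₀) (hu.cs t₀)
  have : ∀ x, (rip (κ t₀ • Lop A B (u t₀) x) (u t₀ x) + rip (u t₀ x) (κ t₀ • Lop A B (u t₀) x))
      * sdet h x = 2 * κ t₀ * (rip (Lop A B (u t₀) x) (u t₀ x) * sdet h x) := fun x => by
    rw [rip_smul_left, rip_smul_right, rip_comm (u t₀ x)]; ring
  simp only [this, integral_const_mul]
  simp only [rip_comm (u t₀ _)] at h1
  rw [show ∫ x in Mset Ω, rip (Lop A B (u t₀) x) (u t₀ x) * sdet h x = 0 by linarith, mul_zero]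

end DiracOp
end evolution

section propagation
variable {Ω : Set (Eu 2)} {β : Eu 2 → Matrix (Fin 2) (Fin 2) ℝ}
  {h : Eu 3 → Matrix (Fin 3) (Fin 3) ℝ} {m : ℝ}
  {A : Fin 3 → Eu 3 → Fin 4 → Fin 4 → ℂ} {B : Eu 3 → Fin 4 → Fin 4 → ℂ}
  {κ : ℝ → ℝ} {u : ℝ → Eu 3 → Fin 4 → ℂ}

theorem exists_cutoff {n : ℕ} {K M : Set (Eu n)} (hK : IsCompact K) (hM : IsOpen M) (hKM : K ⊆ M) :
    ∃ σ : Eu n → ℝ, ContDiff ℝ (⊤ : ℕ∞) σ ∧ (∀ x ∈ K, σ x = 0) ∧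
      ∃ K', IsCompact K' ∧ K' ⊆ M ∧ ∀ x ∉ K', σ x = 1 := by
  obtain ⟨δ, hδ, hδM⟩ := hK.exists_cthickening_subset_open hM hKM
  have hd : Disjoint K (Metric.thickening δ K)ᶜ :=
    disjoint_compl_right_iff_subset.2 (Metric.self_subset_thickening hδ K)
  obtain ⟨f, h0, h1, -⟩ := exists_contMDiffMap_zero_one_of_isClosed (n := (⊤ : ℕ∞))
    (modelWithCornersSelf ℝ (Eu n)) hK.isClosed Metric.isOpen_thickening.isClosed_compl hd
  exact ⟨f, f.contMDiff.contDiff, fun x hx => h0 hx, _, hK.cthickening, hδM,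
    fun x hx => h1 fun hx' => hx (Metric.thickening_subset_cthickening δ K hx')⟩

theorem LocSupp.isOpen {n : ℕ} {F : Type*} [Zero F] (M : Set (Eu n)) (u : ℝ → Eu n → F) :
    IsOpen {t | LocSupp M u t} := by
  refine Metric.isOpen_iff.2 fun t ⟨δ, hδ, K, h1, h2, h3⟩ => ⟨δ / 2, by positivity, fun s hs => ?_⟩
  rw [Metric.mem_ball, Real.dist_eq] at hs
  refine ⟨δ / 2, by positivity, K, h1, h2, fun r hr => h3 r ?_⟩
  calc |r - t| = |(r - s) + (s - t)| := by ring_nf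
    _ ≤ |r - s| + |s - t| := abs_add_le _ _
    _ < δ := by linarith

theorem LocSupp.comp_neg {n : ℕ} {F : Type*} [Zero F] {M : Set (Eu n)} {u : ℝ → Eu n → F} {t : ℝ}
    (hu : LocSupp M u (-t)) : LocSupp M (fun s => u (-s)) t := by
  obtain ⟨δ, hδ, K, h1, h2, h3⟩ := hu
  exact ⟨δ, hδ, K, h1, h2, fun s hs => h3 _ (by rwa [show -s - -t = -(s - t) by ring, abs_neg])⟩

theorem Sol.comp_neg (hu : Sol Ω A B κ u) : Sol Ω A B (fun t => -κ (-t)) fun t => u (-t) where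
  smooth := ContDiffOn.comp hu.smooth (f := fun p : ℝ × Eu 3 => (-p.1, p.2))
    (contDiff_fst.neg.prodMk contDiff_snd).contDiffOn fun _ hp => ⟨trivial, hp.2⟩
  cs t := hu.cs (-t)
  eq t x hx := by
    have := (hu.eq (-t) x hx).scomp t (hasDerivAt_neg t)
    refine this.congr_deriv ?_
    module

namespace DiracOp

theorem _root_.integral_rip_nonneg (f : Eu 3 → Fin 4 → ℂ) :
    0 ≤ ∫ x in Mset Ω, rip (f x) (f x) * sdet h x :=
  integral_nonneg fun _ => mul_nonneg (rip_self_nonneg _) (Real.sqrt_nonneg _)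

/-- The weighted energy of a solution has the transport derivative. -/
theorem hasDerivAt_weighted (D : DiracOp Ω β h m A B) (hu : Sol Ω A B κ u) {t₀ : ℝ}
    (hs : LocSupp (Mset Ω) u t₀) {W W' : ℝ → Eu 3 → ℝ} (hW : JS (Mset Ω) W)
    (hW' : ∀ t, ∀ x ∈ Mset Ω, HasDerivAt (fun s => W s x) (W' t x) t) :
    HasDerivAt (fun t => ∫ x in Mset Ω, rip (W t x • u t x) (u t x) * sdet h x)
      (∫ x in Mset Ω, (W' t₀ x * rip (u t₀ x) (u t₀ x)
        - κ t₀ * rip (symb A x (fun j => pd j (W t₀) x) (u t₀ x)) (u t₀ x)) * sdet h x) t₀ := by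
  have hM := D.isOpen_M
  have hs' : LocSupp (Mset Ω) (fun t x => W t x • u t x) t₀ := by
    obtain ⟨δ, hδ, K, h1, h2, h3⟩ := hs
    exact ⟨δ, hδ, K, h1, h2, fun s hs x hx => by simp [h3 s hs x hx]⟩
  refine (D.hasDerivAt_integral_rip hs' (ContDiffOn.smul hW hu.smooth) hu.smooth
    (fun t x hx => (hW' t x hx).smul (hu.eq t x hx)) hu.eq).congr_deriv ?_
  have hU := hu.cs t₀
  have hWs : SmoothOn (Mset Ω) (W t₀) := hW.slice t₀
  have hWU : CS (Mset Ω) fun x => W t₀ x • u t₀ x := hU.smul_left hWs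
  have hL := D.CS_Lop hU
  have hLW := D.CS_Lop hWU
  have h1 := D.antisymm hWU hU
  have i1 := (D.CS_rip hWU hL.1).integrable hM |>.integrableOn (s := Mset Ω)
  have i2 := (D.CS_rip hLW hU.1).integrable hM |>.integrableOn (s := Mset Ω)
  have hW's : SmoothOn (Mset Ω) (W' t₀) :=
    ((hW.fderiv_apply hM (1, 0)).congr fun t x hx => (hW' t x hx).unique (hW.hasDerivAt hM t hx)).slice t₀
  have i3 := (D.CS_rip (hU.smul_left hW's) hU.1).integrable hM |>.integrableOn (s := Mset Ω)
  have e1 : ∀ x ∈ Mset Ω, (rip (W t₀ x • κ t₀ • Lop A B (u t₀) x + W' t₀ x • u t₀ x) (u t₀ x)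
      + rip (W t₀ x • u t₀ x) (κ t₀ • Lop A B (u t₀) x)) * sdet h x
      = rip (W' t₀ x • u t₀ x) (u t₀ x) * sdet h x
        + 2 * κ t₀ * (rip (W t₀ x • u t₀ x) (Lop A B (u t₀) x) * sdet h x) := fun x _ => by
    simp only [rip_add_left, rip_smul_left, rip_smul_right, rip_comm (Lop A B (u t₀) x)]
    ring
  have e2 : ∀ x ∈ Mset Ω, (W' t₀ x * rip (u t₀ x) (u t₀ x)
        - κ t₀ * rip (symb A x (fun j => pd j (W t₀) x) (u t₀ x)) (u t₀ x)) * sdet h x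
      = rip (W' t₀ x • u t₀ x) (u t₀ x) * sdet h x
        + κ t₀ * (rip (W t₀ x • u t₀ x) (Lop A B (u t₀) x) * sdet h x)
        - κ t₀ * (rip (Lop A B (fun x => W t₀ x • u t₀ x) x) (u t₀ x) * sdet h x) := fun x hx => by
    rw [Lop_smul (hWs.diffAt hM hx) (hU.1.diffAt hM hx)]
    simp only [rip_add_left, rip_smul_left, rip_comm (Lop A B (u t₀) x)]
    ring
  have i4 : IntegrableOn (fun x => rip (W' t₀ x • u t₀ x) (u t₀ x) * sdet h x
      + κ t₀ * (rip (W t₀ x • u t₀ x) (Lop A B (u t₀) x) * sdet h x)) (Mset Ω) :=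
    i3.add (i1.const_mul _)
  rw [setIntegral_congr_fun hM.measurableSet e1, setIntegral_congr_fun hM.measurableSet e2,
    integral_sub i4 (i2.const_mul _), integral_add i3 (i1.const_mul _),
    integral_add i3 (i1.const_mul _)]
  simp only [integral_const_mul, h1]
  ring

/-- Conservation of the `L²` norm on an interval of locally uniform compact support. -/
theorem energy_eq (D : DiracOp Ω β h m A B) (hu : Sol Ω A B κ u) {a b : ℝ} (hab : a ≤ b)
    (hs : ∀ t ∈ Icc a b, LocSupp (Mset Ω) u t) :
    ∫ x in Mset Ω, rip (u b x) (u b x) * sdet h x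
      = ∫ x in Mset Ω, rip (u a x) (u a x) * sdet h x :=
  constant_of_has_deriv_right_zero (f := fun t => ∫ x in Mset Ω, rip (u t x) (u t x) * sdet h x)
    (fun t ht => (D.hasDerivAt_energy hu (hs t ht)).continuousAt.continuousWithinAt)
    (fun t ht => (D.hasDerivAt_energy hu (hs t (Ico_subset_Icc_self ht))).hasDerivWithinAt)
    b (right_mem_Icc.2 hab)

theorem two_mul_abs_integral_rip_le (D : DiracOp Ω β h m A B) {f g : Eu 3 → Fin 4 → ℂ}
    (hf : CS (Mset Ω) f) (hg : CS (Mset Ω) g) :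
    2 * |∫ x in Mset Ω, rip (f x) (g x) * sdet h x|
      ≤ (∫ x in Mset Ω, rip (f x) (f x) * sdet h x) + ∫ x in Mset Ω, rip (g x) (g x) * sdet h x := by
  have hM := D.isOpen_M
  have i1 := (D.CS_rip hf hf.1).integrable hM |>.integrableOn (s := Mset Ω)
  have i2 := (D.CS_rip hg hg.1).integrable hM |>.integrableOn (s := Mset Ω)
  have i3 := (D.CS_rip hf hg.1).integrable hM |>.integrableOn (s := Mset Ω)
  rw [← integral_add i1 i2, ← abs_two, ← abs_mul, ← integral_const_mul]
  refine abs_integral_le_integral_abs.trans (integral_mono (i3.const_mul 2).abs (i1.add i2) fun x => ?_)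
  have := two_mul_abs_rip_le (f x) (g x)
  have hs : 0 ≤ sdet h x := Real.sqrt_nonneg _
  simp only [abs_mul, abs_two, abs_of_nonneg hs]
  nlinarith

/-- A pairing with a fixed test function vanishing on the initial support is small. -/
theorem integral_rip_test_le (D : DiracOp Ω β h m A B) (hu : Sol Ω A B κ u) {a s b : ℝ}
    (has : a < s) (hs : ∀ t ∈ Ioc a s, LocSupp (Mset Ω) u t) (hκ : ∀ t ∈ Icc a s, |κ t| ≤ b)
    {V : Eu 3 → Fin 4 → ℂ} (hV : CS (Mset Ω) V) (h0 : ∀ x, rip (V x) (u a x) = 0) :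
    2 * ∫ x in Mset Ω, rip (V x) (u s x) * sdet h x
      ≤ b * ((∫ x in Mset Ω, rip (V x) (V x) * sdet h x)
        + ∫ x in Mset Ω, rip (Lop A B (u s) x) (Lop A B (u s) x) * sdet h x) * (s - a) := by
  have hd : ∀ t, HasDerivAt (fun t => ∫ x in Mset Ω, rip (V x) (u t x) * sdet h x)
      (κ t * ∫ x in Mset Ω, rip (V x) (Lop A B (u t) x) * sdet h x) t := fun t => by
    have hV' : LocSupp (Mset Ω) (fun _ : ℝ => V) t := by
      obtain ⟨-, K, h1, h2, h3⟩ := hV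
      exact ⟨1, one_pos, K, h1, h2, fun _ _ => h3⟩
    refine (D.hasDerivAt_integral_rip hV' (JS.of_smoothOn hV.1) hu.smooth
      (fun t x _ => hasDerivAt_const t (V x)) hu.eq).congr_deriv ?_
    rw [← integral_const_mul]
    congr 1
    funext x
    rw [rip_zero_left, rip_smul_right]
    ring
  have hb : 0 ≤ b := (abs_nonneg _).trans (hκ s ⟨has.le, le_rfl⟩)
  have key := (convex_Icc a s).image_sub_le_mul_sub_of_deriv_le
    (f := fun t => ∫ x in Mset Ω, rip (V x) (u t x) * sdet h x)
    (fun t _ => (hd t).continuousAt.continuousWithinAt)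
    (fun t _ => (hd t).differentiableAt.differentiableWithinAt)
    (C := b * ((∫ x in Mset Ω, rip (V x) (V x) * sdet h x)
        + ∫ x in Mset Ω, rip (Lop A B (u s) x) (Lop A B (u s) x) * sdet h x) / 2)
    (fun t ht => ?_) a (left_mem_Icc.2 has.le) s (right_mem_Icc.2 has.le) has.le
  · simp only [h0, zero_mul, integral_zero, sub_zero] at key
    linarith
  · rw [interior_Icc] at ht
    rw [(hd t).deriv, D.energy_eq (D.sol_Lop hu) ht.2.le fun r hr =>
      (hs r ⟨ht.1.trans_le hr.1, hr.2⟩).lop]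
    have h1 := D.two_mul_abs_integral_rip_le hV (D.CS_Lop (hu.cs t))
    have h2 := hκ t ⟨ht.1.le, ht.2.le⟩
    refine (le_abs_self _).trans ?_
    rw [abs_mul, mul_div_assoc]
    exact mul_le_mul h2 (by linarith) (abs_nonneg _) hb

/-- Finite speed of propagation, from a compact set into a larger one. -/
theorem exists_propagation (D : DiracOp Ω β h m A B) {K : Set (Eu 3)} (hK : IsCompact K)
    (hKM : K ⊆ Mset Ω) {b : ℝ} (hb : 0 ≤ b) :
    ∃ ε > 0, ∃ K', IsCompact K' ∧ K' ⊆ Mset Ω ∧ K ⊆ K' ∧ ∀ (κ : ℝ → ℝ) (u : ℝ → Eu 3 → Fin 4 → ℂ) (a t₀ : ℝ),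
      Sol Ω A B κ u → a < t₀ → t₀ < a + ε → (∀ t ∈ Icc a t₀, |κ t| ≤ b) →
      (∀ x ∉ K, u a x = 0) → (∀ t ∈ Ioc a t₀, LocSupp (Mset Ω) u t) → ∀ x ∉ K', u t₀ x = 0 := by
  have hM := D.isOpen_M
  obtain ⟨σ, hσ, hσ0, K', hK', hKM', hσ1⟩ := exists_cutoff hK hM hKM
  have hKK' : K ⊆ K' := fun x hx => by
    by_contra hx'
    exact zero_ne_one ((hσ0 x hx).symm.trans (hσ1 x hx'))
  have hσd : Differentiable ℝ σ := hσ.differentiable (by simp)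
  have cont : ContinuousOn (fun x => ∑ i, ∑ j, |pd j σ x| * ∑ k, ‖A j x i k‖) K' := by
    refine continuousOn_finsetSum _ fun i _ => continuousOn_finsetSum _ fun j _ => ContinuousOn.mul ?_
      (continuousOn_finsetSum _ fun k _ => ((D.smoothA j i k).continuousOn.mono hKM').norm)
    have : SmoothOn univ (pd j σ) := SmoothOn.pderiv hσ.contDiffOn isOpen_univ j
    exact (this.continuousOn.mono (subset_univ _)).abs
  obtain ⟨c₁, hc₁⟩ := hK'.exists_bound_of_continuousOn cont
  have hsymb : ∀ x ∈ Mset Ω, ∀ v, |rip (symb A x (fun j => pd j σ x) v) v| ≤ |c₁| * rip v v := by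
    intro x hx v
    by_cases hxK : x ∈ K'
    · refine (abs_rip_symb_le A x _ v).trans (mul_le_mul_of_nonneg_right ?_ (rip_self_nonneg v))
      exact (le_abs_self _).trans ((hc₁ x hxK).trans (le_abs_self _))
    · have : ∀ j, pd j σ x = 0 := fun j => by
        rw [pd_congr hK'.isClosed.isOpen_compl (g := fun _ => 1) (fun y hy => hσ1 y hy) hxK, pd_const]
      refine (abs_rip_symb_le A x _ v).trans ?_
      simp only [this, abs_zero, zero_mul, Finset.sum_const_zero]
      exact mul_nonneg (abs_nonneg _) (rip_self_nonneg v)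
  set c := b * |c₁| with hc
  have hc0 : 0 ≤ c := by positivity
  refine ⟨1 / (2 * (c + 1)), by positivity, K', hK', hKM', hKK', ?_⟩
  intro κ u a t₀ hu ha ht hκ hua hG x hx
  by_cases hxM : x ∉ Mset Ω
  · exact (hu.cs t₀).eq_zero hxM
  rw [not_not] at hxM
  have hct : c * (t₀ - a) < 1 := by
    have h1 : t₀ - a < 1 / (2 * (c + 1)) := by linarith
    rw [lt_div_iff₀ (by positivity)] at h1
    nlinarith
  let W : ℝ → Eu 3 → ℝ := fun t x => smoothTransition (σ x - c * (t - a))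
  have hθ : ∀ y, HasDerivAt smoothTransition (deriv smoothTransition y) y := fun y =>
    ((smoothTransition.contDiff (n := 1)).differentiable (by simp) y).hasDerivAt
  have hθ' : ∀ y, 0 ≤ deriv smoothTransition y := fun y => smoothTransition.monotone.deriv_nonneg
  have hW : JS (Mset Ω) W := by
    refine ContDiff.contDiffOn ((smoothTransition.contDiff (n := (⊤ : ℕ∞))).comp ?_)
    exact (hσ.comp contDiff_snd).sub (contDiff_const.mul (contDiff_fst.sub contDiff_const))
  have hWt : ∀ t, ∀ x ∈ Mset Ω, HasDerivAt (fun s => W s x)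
      (deriv smoothTransition (σ x - c * (t - a)) * (-c)) t := fun t x _ => by
    refine (hθ _).comp t ?_
    have := (((hasDerivAt_id t).sub_const a).const_mul c).const_sub (σ x)
    simpa using this
  have hWx : ∀ t x j, pd j (W t) x = deriv smoothTransition (σ x - c * (t - a)) * pd j σ x := by
    intro t x j
    have h1 : HasFDerivAt (fun x => σ x - c * (t - a)) (fderiv ℝ σ x) x :=
      (hσd x).hasFDerivAt.sub_const _
    have h2 := ((hθ (σ x - c * (t - a))).comp_hasFDerivAt x h1).fderiv
    unfold pd
    rw [show W t = smoothTransition ∘ fun x => σ x - c * (t - a) from rfl, h2]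
    simp
  let E : ℝ → ℝ := fun t => ∫ x in Mset Ω, rip (W t x • u t x) (u t x) * sdet h x
  have hE : ∀ t ∈ Ioc a t₀, ∃ e ≤ 0, HasDerivAt E e t := fun t ht => by
    refine ⟨_, ?_, D.hasDerivAt_weighted hu (hG t ht) hW hWt⟩
    refine setIntegral_nonpos hM.measurableSet fun x hx => ?_
    refine mul_nonpos_of_nonpos_of_nonneg ?_ (Real.sqrt_nonneg _)
    have e : symb A x (fun j => pd j (W t) x) (u t x)
        = deriv smoothTransition (σ x - c * (t - a)) • symb A x (fun j => pd j σ x) (u t x) := by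
      funext i
      simp only [symb, hWx, Pi.smul_apply, Complex.real_smul, Finset.mul_sum]
      push_cast
      exact Finset.sum_congr rfl fun _ _ => Finset.sum_congr rfl fun _ _ => by ring
    rw [e, rip_smul_left]
    have h1 := hsymb x hx (u t x)
    have h2 := hκ t ⟨ht.1.le, ht.2⟩
    have h3 := hθ' (σ x - c * (t - a))
    have h4 : |κ t * rip (symb A x (fun j => pd j σ x) (u t x)) (u t x)| ≤ c * rip (u t x) (u t x) := by
      rw [abs_mul, hc, mul_assoc]
      exact mul_le_mul h2 h1 (abs_nonneg _) hb
    nlinarith [neg_abs_le (κ t * rip (symb A x (fun j => pd j σ x) (u t x)) (u t x))]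
  have hV : SmoothOn (Mset Ω) fun x => smoothTransition (σ x) :=
    ((smoothTransition.contDiff (n := (⊤ : ℕ∞))).comp hσ).contDiffOn
  set Q : ℝ := (∫ x in Mset Ω, rip (u t₀ x) (u t₀ x) * sdet h x)
    + ∫ x in Mset Ω, rip (Lop A B (u t₀) x) (Lop A B (u t₀) x) * sdet h x with hQ
  have hEs : ∀ s ∈ Ioc a t₀, E t₀ ≤ b * Q * (s - a) := fun s hs => by
    have hGs : ∀ t ∈ Icc s t₀, LocSupp (Mset Ω) u t := fun t ht => hG t ⟨hs.1.trans_le ht.1, ht.2⟩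
    have hsub : Icc s t₀ ⊆ Ioc a t₀ := fun t ht => ⟨hs.1.trans_le ht.1, ht.2⟩
    have h1 : E t₀ ≤ E s := by
      refine antitoneOn_of_deriv_nonpos (convex_Icc s t₀) (fun t ht => ?_) (fun t ht => ?_)
        (fun t ht => ?_) (left_mem_Icc.2 hs.2) (right_mem_Icc.2 hs.2) hs.2
      · obtain ⟨e, -, he⟩ := hE t (hsub ht)
        exact he.continuousAt.continuousWithinAt
      · obtain ⟨e, -, he⟩ := hE t (hsub (interior_subset ht))
        exact he.differentiableAt.differentiableWithinAt
      · obtain ⟨e, he0, he⟩ := hE t (hsub (interior_subset ht))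
        rwa [he.deriv]
    have hU := hu.cs s
    have hVs : CS (Mset Ω) fun x => smoothTransition (σ x) • u s x := hU.smul_left hV
    have h2 : E s ≤ ∫ x in Mset Ω, rip (smoothTransition (σ x) • u s x) (u s x) * sdet h x := by
      refine setIntegral_mono ((D.CS_rip (hU.smul_left (hW.slice s)) hU.1).integrable hM).integrableOn
        ((D.CS_rip hVs hU.1).integrable hM).integrableOn fun x => ?_
      refine mul_le_mul_of_nonneg_right ?_ (Real.sqrt_nonneg _)
      rw [rip_smul_left, rip_smul_left]
      refine mul_le_mul_of_nonneg_right (smoothTransition.monotone ?_) (rip_self_nonneg _)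
      have : 0 ≤ c * (s - a) := mul_nonneg hc0 (by linarith [hs.1])
      linarith
    have h3 := D.integral_rip_test_le hu hs.1 (fun t ht => hG t ⟨ht.1, ht.2.trans hs.2⟩)
      (fun t ht => hκ t ⟨ht.1, ht.2.trans hs.2⟩) hVs fun x => by
        by_cases hxK : x ∈ K
        · rw [hσ0 x hxK, smoothTransition.zero, zero_smul, rip_zero_left]
        · rw [hua x hxK, rip_comm, rip_zero_left]
    have h4 : ∫ x in Mset Ω, rip (smoothTransition (σ x) • u s x) (smoothTransition (σ x) • u s x)
        * sdet h x ≤ ∫ x in Mset Ω, rip (u s x) (u s x) * sdet h x := by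
      refine setIntegral_mono ((D.CS_rip hVs hVs.1).integrable hM).integrableOn
        ((D.CS_rip hU hU.1).integrable hM).integrableOn fun x => ?_
      refine mul_le_mul_of_nonneg_right ?_ (Real.sqrt_nonneg _)
      rw [rip_smul_left, rip_smul_right, ← mul_assoc]
      exact mul_le_of_le_one_left (rip_self_nonneg _) (mul_le_one₀ (smoothTransition.le_one _)
        (smoothTransition.nonneg _) (smoothTransition.le_one _))
    have h5 := D.energy_eq hu hs.2 hGs
    have h6 := D.energy_eq (D.sol_Lop hu) hs.2 fun t ht => (hGs t ht).lop
    have h7 : 0 ≤ Q := add_nonneg (integral_rip_nonneg _) (integral_rip_nonneg _)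
    have h8 : b * ((∫ x in Mset Ω, rip (smoothTransition (σ x) • u s x) (smoothTransition (σ x) • u s x)
        * sdet h x) + ∫ x in Mset Ω, rip (Lop A B (u s) x) (Lop A B (u s) x) * sdet h x) * (s - a)
        ≤ b * Q * (s - a) := by
      refine mul_le_mul_of_nonneg_right (mul_le_mul_of_nonneg_left ?_ hb) (by linarith [hs.1])
      rw [hQ, h5, h6]
      linarith
    have h9 : 0 ≤ E s := integral_nonneg fun x => mul_nonneg (by
      rw [rip_smul_left]; exact mul_nonneg (smoothTransition.nonneg _) (rip_self_nonneg _))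
      (Real.sqrt_nonneg _)
    linarith
  have hE0 : E t₀ ≤ 0 := by
    have hlim : Filter.Tendsto (fun s => b * Q * (s - a)) (nhdsWithin a (Ioi a)) (nhds 0) := by
      have : Continuous fun s => b * Q * (s - a) := by fun_prop
      simpa using (this.tendsto a).mono_left nhdsWithin_le_nhds
    exact ge_of_tendsto hlim (Filter.mem_of_superset (Ioc_mem_nhdsGT ha) hEs)
  have hCS := D.CS_rip ((hu.cs t₀).smul_left (hW.slice t₀)) (hu.cs t₀).1
  by_contra hne
  have hWpos : 0 < W t₀ x := smoothTransition.pos_of_pos (by rw [hσ1 x hx]; linarith)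
  have hpos : 0 < ∫ x, rip (W t₀ x • u t₀ x) (u t₀ x) * sdet h x := by
    refine (hCS.contDiff hM).continuous.integral_pos_of_hasCompactSupport_nonneg_nonzero
      hCS.hasCompactSupport (fun y => mul_nonneg ?_ (Real.sqrt_nonneg _)) (x := x) ?_
    · rw [rip_smul_left]; exact mul_nonneg (smoothTransition.nonneg _) (rip_self_nonneg _)
    · rw [rip_smul_left]
      exact mul_ne_zero (mul_ne_zero hWpos.ne' fun h0 => hne (eq_zero_of_rip_self h0))
        (D.sdet_M_pos hxM).ne'
  rw [← hCS.integral_eq] at hpos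
  exact absurd hE0 (not_le.2 hpos)

end DiracOp
end propagation

/-- An open set is exhausted by countably many compact subsets. -/
theorem exists_compact_exhaustion {n : ℕ} {M : Set (Eu n)} (hM : IsOpen M) :
    ∃ K : ℕ → Set (Eu n), (∀ k, IsCompact (K k)) ∧ (∀ k, K k ⊆ M) ∧
      ∀ L, IsCompact L → L ⊆ M → ∃ k, L ⊆ K k := by
  have := hM.locallyCompactSpace
  obtain ⟨E⟩ : Nonempty (CompactExhaustion M) := ⟨default⟩
  refine ⟨fun k => (↑) '' E k, fun k => (E.isCompact k).image continuous_subtype_val,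
    fun k => Subtype.coe_image_subset _ _, fun L hL hLM => ?_⟩
  have hL' : IsCompact ((↑) ⁻¹' L : Set M) := by
    rw [Subtype.isCompact_iff, Subtype.image_preimage_coe, inter_eq_right.2 hLM]
    exact hL
  obtain ⟨k, hk⟩ := E.exists_superset_of_isCompact hL'
  exact ⟨k, fun x hx => ⟨⟨x, hLM hx⟩, hk hx, rfl⟩⟩

section baire
variable {Ω : Set (Eu 2)} {β : Eu 2 → Matrix (Fin 2) (Fin 2) ℝ}
  {h : Eu 3 → Matrix (Fin 3) (Fin 3) ℝ} {m : ℝ}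
  {A : Fin 3 → Eu 3 → Fin 4 → Fin 4 → ℂ} {B : Eu 3 → Fin 4 → Fin 4 → ℂ}
  {κ : ℝ → ℝ} {u : ℝ → Eu 3 → Fin 4 → ℂ}

/-- There is a last exceptional time before a time of locally uniform compact support. -/
theorem exists_last_exceptional {n : ℕ} {F : Type*} [Zero F] {M : Set (Eu n)} {u : ℝ → Eu n → F}
    {a t : ℝ} (hat : a ≤ t) (ha : ¬ LocSupp M u a) (ht : LocSupp M u t) :
    ∃ s ∈ Ico a t, ¬ LocSupp M u s ∧ ∀ r ∈ Ioc s t, LocSupp M u r := by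
  have hF : IsClosed {t | ¬ LocSupp M u t} := (LocSupp.isOpen M u).isClosed_compl
  have hc : IsCompact ({t | ¬ LocSupp M u t} ∩ Icc a t) := isCompact_Icc.inter_left hF
  have hm := hc.sSup_mem ⟨a, ha, le_rfl, hat⟩
  refine ⟨_, ⟨hm.2.1, lt_of_le_of_ne hm.2.2 fun e => hm.1 ?_⟩, hm.1, fun r hr => ?_⟩
  · rwa [e]
  · by_contra hr'
    exact absurd (le_csSup hc.bddAbove ⟨hr', hm.2.1.trans hr.1.le, hr.2⟩) (not_le.2 hr.1)

namespace DiracOp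

/-- Smooth solutions with spatially compact support have locally uniform compact support. -/
theorem locSupp (D : DiracOp Ω β h m A B) (hu : Sol Ω A B κ u) (hκ : Continuous κ) (t : ℝ) :
    LocSupp (Mset Ω) u t := by
  by_contra ht
  have hM := D.isOpen_M
  obtain ⟨K, hK, hKM, hKe⟩ := exists_compact_exhaustion hM
  have hF : IsClosed {t | ¬ LocSupp (Mset Ω) u t} := (LocSupp.isOpen _ u).isClosed_compl
  have := hF.completeSpace_coe
  have : Nonempty {t | ¬ LocSupp (Mset Ω) u t} := ⟨⟨t, ht⟩⟩
  obtain ⟨k, a, hak⟩ := nonempty_interior_of_iUnion_of_closed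
    (f := fun k => {s : {t | ¬ LocSupp (Mset Ω) u t} | ∀ x ∉ K k, u s x = 0}) (fun k => by
      simp only [ofPred_forall]
      refine isClosed_iInter fun x => isClosed_iInter fun _ => ?_
      by_cases hx : x ∈ Mset Ω
      · have : Continuous fun s => u s x :=
          continuous_iff_continuousAt.2 fun s => (hu.eq s x hx).continuousAt
        exact isClosed_eq (this.comp continuous_subtype_val) continuous_const
      · simp [(hu.cs _).eq_zero hx]) (by
      refine eq_univ_of_forall fun s => mem_iUnion.2 ?_
      obtain ⟨-, L, h1, h2, h3⟩ := hu.cs s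
      obtain ⟨k, hk⟩ := hKe L h1 h2
      exact ⟨k, fun x hx => h3 x fun h => hx (hk h)⟩)
  obtain ⟨δ, hδ, hδk⟩ := Metric.mem_nhds_iff.1 (mem_interior_iff_mem_nhds.1 hak)
  have hk : ∀ s, ¬ LocSupp (Mset Ω) u s → |s - a| < δ → ∀ x ∉ K k, u s x = 0 := fun s hs hsa =>
    hδk (show (⟨s, hs⟩ : {t | ¬ LocSupp (Mset Ω) u t}) ∈ Metric.ball a δ by
      rw [Metric.mem_ball, Subtype.dist_eq, Real.dist_eq]; exact hsa)
  obtain ⟨b, hb⟩ := (isCompact_Icc (a := (a : ℝ) - 1) (b := a + 1)).exists_bound_of_continuousOn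
    hκ.continuousOn
  have hb0 : 0 ≤ b := (norm_nonneg _).trans (hb a ⟨by linarith, by linarith⟩)
  obtain ⟨ε, hε, K', h1, h2, h3, h4⟩ := D.exists_propagation (hK k) (hKM k) hb0
  refine a.2 ⟨min δ (min ε 1), by positivity, K', h1, h2, fun t hta x hx => ?_⟩
  rw [lt_min_iff, lt_min_iff] at hta
  obtain ⟨hd, he, ho⟩ := hta
  by_cases hG : LocSupp (Mset Ω) u t
  · rcases le_total (a : ℝ) t with hat | hat
    · obtain ⟨s, hs, hsF, hsG⟩ := exists_last_exceptional hat a.2 hG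
      rw [abs_of_nonneg (by linarith)] at hd he ho
      exact h4 κ u s t hu hs.2 (by linarith [hs.1])
        (fun r hr => hb r ⟨by linarith [hs.1, hr.1], by linarith [hr.2]⟩)
        (hk s hsF (by rw [abs_of_nonneg (by linarith [hs.1])]; linarith [hs.2])) hsG x hx
    · have hn : ∀ r, LocSupp (Mset Ω) (fun s => u (-s)) r ↔ LocSupp (Mset Ω) u (-r) := fun r =>
        ⟨fun hr => by
          have := LocSupp.comp_neg (u := fun s => u (-s)) (t := -r) (by rwa [neg_neg])
          simpa using this, LocSupp.comp_neg⟩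
      obtain ⟨s, hs, hsF, hsG⟩ := exists_last_exceptional (u := fun s => u (-s)) (neg_le_neg hat)
        (by rw [hn, neg_neg]; exact a.2) (by rwa [hn, neg_neg])
      rw [abs_of_nonpos (by linarith)] at hd he ho
      have := h4 _ _ s (-t) hu.comp_neg hs.2 (by linarith [hs.1])
        (fun r hr => by
          rw [abs_neg]; exact hb (-r) ⟨by linarith [hr.2], by linarith [hs.1, hr.1]⟩)
        (hk (-s) (fun h => hsF ((hn s).2 h))
          (by rw [abs_of_nonpos (by linarith [hs.1])]; linarith [hs.2])) hsG x hx
      simpa using this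
  · exact hk t hG hd x fun hxK => hx (h3 hxK)

end DiracOp
end baire

section smoothing
variable {Ω : Set (Eu 2)} {β : Eu 2 → Matrix (Fin 2) (Fin 2) ℝ}
  {h : Eu 3 → Matrix (Fin 3) (Fin 3) ℝ} {η m : ℝ}
  {A : Fin 3 → Eu 3 → Fin 4 → Fin 4 → ℂ} {B : Eu 3 → Fin 4 → Fin 4 → ℂ}
  {κ : ℝ → ℝ} {u : ℝ → Eu 3 → Fin 4 → ℂ}

theorem JS.Xop {F : Type*} [NormedAddCommGroup F] [NormedSpace ℝ F] {v : ℝ → Eu 3 → F}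
    (hv : JS (Mset Ω) v) (hΩ : IsOpen Ω) : JS (Mset Ω) fun t => Xop η (v t) :=
  ((JS.of_smoothOn (smoothOn_radial contDiffOn_mul1)).smul (hv.pderiv (isOpen_Mset hΩ) 0)).add
    ((JS.of_smoothOn (smoothOn_radial contDiffOn_mul0)).smul hv)

theorem JS.hasDerivAt_Xop {F : Type*} [NormedAddCommGroup F] [NormedSpace ℝ F]
    {v v' : ℝ → Eu 3 → F} (hv : JS (Mset Ω) v) (hΩ : IsOpen Ω)
    (hd : ∀ t, ∀ x ∈ Mset Ω, HasDerivAt (fun s => v s x) (v' t x) t) (t : ℝ) {x : Eu 3}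
    (hx : x ∈ Mset Ω) : HasDerivAt (fun s => _root_.Xop η (v s) x) (_root_.Xop η (v' t) x) t :=
  ((hv.hasDerivAt_pd (isOpen_Mset hΩ) hd t hx 0).const_smul _).add ((hd t x hx).const_smul _)

theorem Xop_const_smul {F : Type*} [NormedAddCommGroup F] [NormedSpace ℝ F] (r : ℝ) {f : Eu 3 → F}
    {x : Eu 3} (hf : DifferentiableAt ℝ f x) : Xop η (fun y => r • f y) x = r • Xop η f x := by
  simp only [Xop, pd_smul (differentiableAt_const r) hf, pd_const, zero_smul, add_zero]
  module

namespace DiracOp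

/-- The virial identity. -/
theorem hasDerivAt_virial (D : DiracOp Ω β h m A B) (hη : 0 < η) (hu : Sol Ω A B κ u) {t₀ : ℝ}
    (hs : LocSupp (Mset Ω) u t₀) :
    HasDerivAt (fun t => ∫ x in Mset Ω, rip (Lop A B (u t) x) (Xop η (u t) x) * sdet h x)
      (κ t₀ * ∫ x in Mset Ω, rip (Lop A B (Lop A B (u t₀)) x) (Xop η (u t₀) x) * sdet h x) t₀ := by
  have hM := D.isOpen_M
  have hL := D.sol_Lop hu
  have hU := hu.cs t₀
  refine (D.hasDerivAt_integral_rip hs.lop hL.smooth (hu.smooth.Xop D.isOpen (η := η)) hL.eq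
    fun t x hx => hu.smooth.hasDerivAt_Xop D.isOpen hu.eq t hx).congr_deriv ?_
  have i1 := D.integrableOn_CS (D.CS_rip (D.CS_Lop (D.CS_Lop hU)) (hU.Xop D.isOpen (η := η)).1)
  have i2 := D.integrableOn_CS (D.CS_rip (D.CS_Lop hU) ((D.CS_Lop hU).Xop D.isOpen (η := η)).1)
  have e : ∀ x ∈ Mset Ω, (rip (κ t₀ • Lop A B (Lop A B (u t₀)) x) (Xop η (u t₀) x)
      + rip (Lop A B (u t₀) x) (Xop η (fun y => κ t₀ • Lop A B (u t₀) y) x)) * sdet h x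
      = κ t₀ * (rip (Lop A B (Lop A B (u t₀)) x) (Xop η (u t₀) x) * sdet h x)
        + κ t₀ * (rip (Lop A B (u t₀) x) (Xop η (Lop A B (u t₀)) x) * sdet h x) := fun x hx => by
    rw [Xop_const_smul _ ((D.CS_Lop hU).1.diffAt hM hx), rip_smul_left, rip_smul_right]
    ring
  rw [setIntegral_congr_fun hM.measurableSet e, integral_add (i1.const_mul _) (i2.const_mul _),
    integral_const_mul, integral_const_mul, D.integral_rip_Xop hη (D.CS_Lop hU)]
  ring

/-- Local smoothing on a bounded time interval, with a constant independent of the interval. -/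
theorem intervalIntegral_smoothing_le (D : DiracOp Ω β h m A B) {η₁ η₂ : ℝ} (hη : 0 < η)
    (h1 : η ≤ η₁) (h2 : η ≤ η₂) (hu : Sol Ω A B κ u) (hκc : Continuous κ) (hκ : ∀ t, 0 ≤ κ t)
    {F : ℝ → ℝ} (hF : ∀ t, F t = κ t * ∫ x in Mset Ω,
      ((1 + (x 0) ^ 2) ^ (-(3 / 2 + η₁)) * (∑ c, ‖u t x c‖ ^ 2)
        + (1 + (x 0) ^ 2) ^ (-(1 / 2 + η₂)) * gradhSq h (u t) x) * sdet h x)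
    (hFi : Integrable F) {T : ℝ} (hT : 0 ≤ T) :
    ∫ t in (-T)..T, F t ≤ 2 * morConst η * (1 / 2 + 5 * (1 / η + 1 / 2) ^ 2)
      * ∫ x in Mset Ω, rip (Lop A B (u 0) x) (Lop A B (u 0) x) * sdet h x := by
  have hs := D.locSupp hu hκc
  have hc : 0 ≤ morConst η := morConst_pos hη |>.le
  set Θ := fun t => ∫ x in Mset Ω, rip (Lop A B (u t) x) (Xop η (u t) x) * sdet h x
  have hd := fun t => (D.hasDerivAt_virial hη hu (hs t)).const_mul (-morConst η)
  have key := intervalIntegral.integral_le_sub_of_hasDeriv_right_of_le (a := -T) (b := T)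
    (g := fun t => -morConst η * Θ t) (φ := F) (by linarith)
    (fun t _ => (hd t).continuousAt.continuousWithinAt) (fun t _ => (hd t).hasDerivWithinAt)
    hFi.integrableOn fun t _ => by
      rw [hF]
      have e1 := D.integral_weights_le hη h1 h2 (hu.cs t)
      have e2 := D.integral_Lop_Lop_Xop_le hη (hu.cs t)
      calc _ ≤ κ t * (morConst η * ∫ x in Mset Ω, ∑ p, morDens β η (fun y => rc p (u t y)) x) :=
            mul_le_mul_of_nonneg_left e1 (hκ t)
        _ ≤ κ t * (morConst η * -∫ x in Mset Ω,
            rip (Lop A B (Lop A B (u t)) x) (Xop η (u t) x) * sdet h x) :=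
            mul_le_mul_of_nonneg_left (mul_le_mul_of_nonneg_left (by linarith) hc) (hκ t)
        _ = _ := by ring
  have hL := D.sol_Lop hu
  have e1 := D.energy_eq hL hT fun t _ => (hs t).lop
  have e2 := D.energy_eq hL (neg_nonpos.2 hT) fun t _ => (hs t).lop
  have b1 := D.abs_integral_Lop_Xop_le hη (hu.cs T)
  have b2 := D.abs_integral_Lop_Xop_le hη (hu.cs (-T))
  rw [e1] at b1
  rw [← e2] at b2
  have b3 : Θ (-T) - Θ T ≤ 2 * ((1 / 2 + 5 * (1 / η + 1 / 2) ^ 2)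
      * ∫ x in Mset Ω, rip (Lop A B (u 0) x) (Lop A B (u 0) x) * sdet h x) := by
    linarith [le_abs_self (Θ (-T)), neg_abs_le (Θ T)]
  refine key.trans ?_
  have := mul_le_mul_of_nonneg_left b3 hc
  linarith

/-- Local smoothing on the whole time axis. -/
theorem integral_smoothing_le (D : DiracOp Ω β h m A B) {η₁ η₂ : ℝ} (hη : 0 < η)
    (h1 : η ≤ η₁) (h2 : η ≤ η₂) (hu : Sol Ω A B κ u) (hκc : Continuous κ) (hκ : ∀ t, 0 ≤ κ t) :
    (∫ t : ℝ, κ t * ∫ x in Mset Ω,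
      ((1 + (x 0) ^ 2) ^ (-(3 / 2 + η₁)) * (∑ c, ‖u t x c‖ ^ 2)
        + (1 + (x 0) ^ 2) ^ (-(1 / 2 + η₂)) * gradhSq h (u t) x) * sdet h x)
      ≤ 2 * morConst η * (1 / 2 + 5 * (1 / η + 1 / 2) ^ 2)
        * ∫ x in Mset Ω, rip (Lop A B (u 0) x) (Lop A B (u 0) x) * sdet h x := by
  set F := fun t : ℝ => κ t * ∫ x in Mset Ω,
      ((1 + (x 0) ^ 2) ^ (-(3 / 2 + η₁)) * (∑ c, ‖u t x c‖ ^ 2)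
        + (1 + (x 0) ^ 2) ^ (-(1 / 2 + η₂)) * gradhSq h (u t) x) * sdet h x with hF
  by_cases hFi : Integrable F
  · exact le_of_tendsto (intervalIntegral_tendsto_integral hFi Filter.tendsto_neg_atTop_atBot
      Filter.tendsto_id) ((Filter.eventually_ge_atTop 0).mono fun T hT =>
        D.intervalIntegral_smoothing_le hη h1 h2 hu hκc hκ (fun t => rfl) hFi hT)
  · rw [integral_undef hFi]
    exact mul_nonneg (by have := morConst_pos hη; positivity) (integral_rip_nonneg _)

end DiracOp

/-- The Dirac equation `iφ∂ₜu = Hu` in the form `∂ₜu = φ⁻¹Lu`. -/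
theorem Sol.of_dirac {φ : ℝ → ℝ} (hΩ : IsOpen Ω) (hφ : ∀ t, 0 < φ t) (hu : JS (Mset Ω) u)
    (hc : ∀ t, HasCompactSupport (u t) ∧ tsupport (u t) ⊆ Mset Ω)
    (he : ∀ t : ℝ, ∀ x ∈ Mset Ω, ∀ c : Fin 4,
      Complex.I * ((φ t : ℝ) : ℂ) * deriv (fun s => u s x c) t = Hop A B (u t) x c) :
    Sol Ω A B (fun t => (φ t)⁻¹) u where
  smooth := hu
  cs t := ⟨hu.slice t, _, (hc t).1, (hc t).2, fun _ hx => image_eq_zero_of_notMem_tsupport hx⟩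
  eq t x hx := by
    have hd := hu.hasDerivAt (isOpen_Mset hΩ) t hx
    refine hd.congr_deriv (funext fun c => ?_)
    have h1 := he t x hx c
    rw [(hasDerivAt_pi.1 hd c).deriv] at h1
    have hφ' : ((φ t : ℝ) : ℂ) ≠ 0 := Complex.ofReal_ne_zero.2 (hφ t).ne'
    simp only [Pi.smul_apply, Lop, Complex.real_smul, smul_eq_mul, ← h1, Complex.ofReal_inv]
    field_simp
    rw [Complex.I_sq]
    ring

end smoothing

/-- **Local smoothing for the Dirac equation on flat-type wrapped products**
(`d(r) = r²`, `R_β ≥ 2`). -/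
theorem stmt3 :
    ∀ η₁ : ℝ, 0 < η₁ → ∀ η₂ : ℝ, 0 < η₂ → ∃ C > (0 : ℝ),
      ∀ Ω : Set (Eu 2), IsOpen Ω →
      ∀ β : Eu 2 → Matrix (Fin 2) (Fin 2) ℝ,
        (∀ i j : Fin 2, ContDiffOn ℝ (⊤ : ℕ∞) (fun y => β y i j) Ω) →
        (∀ y ∈ Ω, (β y).IsSymm) → (∀ y ∈ Ω, (β y).PosDef) →
        (∀ y ∈ Ω, 2 ≤ Rscal β y) →
      ∀ h : Eu 3 → Matrix (Fin 3) (Fin 3) ℝ,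
        (∀ x, (h x).IsSymm) → (∀ x, (h x).PosDef) →
        WrapMetric Ω β (fun r => r ^ 2) h →
      ∀ m : ℝ, 0 ≤ m →
      ∀ φ : ℝ → ℝ, ContDiff ℝ (⊤ : ℕ∞) φ → (∀ t, 0 < φ t) →
      ∀ (A : Fin 3 → Eu 3 → Fin 4 → Fin 4 → ℂ) (B : Eu 3 → Fin 4 → Fin 4 → ℂ),
        (∀ j i k, ContDiffOn ℝ (⊤ : ℕ∞) (fun x => A j x i k) (Mset Ω)) →
        (∀ i k, ContDiffOn ℝ (⊤ : ℕ∞) (fun x => B x i k) (Mset Ω)) →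
        (∀ f g : Eu 3 → Fin 4 → ℂ, ContDiff ℝ (⊤ : ℕ∞) f → ContDiff ℝ (⊤ : ℕ∞) g →
          HasCompactSupport f → HasCompactSupport g →
          tsupport f ⊆ Mset Ω → tsupport g ⊆ Mset Ω →
          innM Ω h (Hop A B f) g = innM Ω h f (Hop A B g)) →
        (∀ f : Eu 3 → Fin 4 → ℂ, ContDiff ℝ (⊤ : ℕ∞) f → ∀ x ∈ Mset Ω, ∀ i : Fin 4,
          Hop A B (Hop A B f) x i
            = ((m : ℂ) ^ 2) * f x i - lapC h (fun y => f y i) x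
              + ((Rscal h x / 4 : ℝ) : ℂ) * f x i) →
      ∀ (u : ℝ → Eu 3 → Fin 4 → ℂ) (u₀ : Eu 3 → Fin 4 → ℂ),
        ContDiffOn ℝ (⊤ : ℕ∞) (fun p : ℝ × Eu 3 => u p.1 p.2)
          ((Set.univ : Set ℝ) ×ˢ Mset Ω) →
        (∀ t, HasCompactSupport (u t) ∧ tsupport (u t) ⊆ Mset Ω) →
        (∀ t : ℝ, ∀ x ∈ Mset Ω, ∀ c : Fin 4,
          Complex.I * ((φ t : ℝ) : ℂ) * deriv (fun s => u s x c) t = Hop A B (u t) x c) →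
        (∀ x ∈ Mset Ω, u 0 x = u₀ x) →
        (∫ t : ℝ, (φ t)⁻¹ *
            ∫ x in Mset Ω,
              ((1 + (x 0) ^ 2) ^ (-(3 / 2 + η₁)) * (∑ c, ‖u t x c‖ ^ 2)
                + (1 + (x 0) ^ 2) ^ (-(1 / 2 + η₂)) * gradhSq h (u t) x) * sdet h x)
          ≤ C * ∫ x in Mset Ω, (∑ c, ‖Hop A B u₀ x c‖ ^ 2) * sdet h x := by
  intro η₁ hη₁ η₂ hη₂
  have hη : 0 < min η₁ η₂ := lt_min hη₁ hη₂
  have hc := morConst_pos hη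
  refine ⟨2 * morConst (min η₁ η₂) * (1 / 2 + 5 * (1 / min η₁ η₂ + 1 / 2) ^ 2), by positivity, ?_⟩
  intro Ω hΩ β hβ hβs hβp hR h _ _ hw m _ φ hφ hφ0 A B hA hB hsym hsq u u₀ hu hus hue hu0
  have D : DiracOp Ω β h m A B := ⟨⟨hΩ, hβ, hβs, hβp, hw⟩, hR, hA, hB, hsym, hsq⟩
  have e : ∀ x ∈ Mset Ω, rip (Lop A B (u 0) x) (Lop A B (u 0) x) * sdet h x
      = (∑ c, ‖Hop A B u₀ x c‖ ^ 2) * sdet h x := fun x hx => by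
    rw [rip_Lop_self, Hop_congr D.isOpen_M hu0 hx]
  rw [← setIntegral_congr_fun D.isOpen_M.measurableSet e]
  exact D.integral_smoothing_le hη (min_le_left _ _) (min_le_right _ _)
    (Sol.of_dirac hΩ hφ0 hu hus hue) (hφ.continuous.inv₀ fun t => (hφ0 t).ne')
    fun t => (inv_pos.2 (hφ0 t)).le
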